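/- Let 1 < p ≤ q < ∞. If E and F contain complemented subspaces isomorphic to ℓ_p and ℓ_q respectively, then for every n ≥ 1, the space P(ⁿE;F) of continuous n-homogeneous polynomials from E to F does not have the approximation property. -/

import Mathlib

open scoped ENNReal

noncomputable section

/-- A normed space `E` has the approximation property if for every compact set `K` and `ε > 0`
there is a finite rank bounded operator `T : E → E` with `‖T x - x‖ < ε` on `K`. -/
def HasAP (𝕜 E : Type*) [NontriviallyNormedField 𝕜] [SeminormedAddCommGroup E]
    [NormedSpace 𝕜 E] : Prop :=
  ∀ K : Set E, IsCompact K → ∀ ε : ℝ, 0 < ε →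
    ∃ T : E →L[𝕜] E, FiniteDimensional 𝕜 (LinearMap.range (T : E →ₗ[𝕜] E)) ∧
      ∀ x ∈ K, ‖T x - x‖ < ε

/-- The closed subspace of symmetric continuous `n`-linear maps, our model for the Banach space
`P(ⁿE;F)` of continuous `n`-homogeneous polynomials from `E` to `F` (a polynomial is identified
with its unique symmetric generating multilinear map). -/
def SymmCM (𝕜 : Type*) [NontriviallyNormedField 𝕜] (n : ℕ) (E F : Type*)
    [NormedAddCommGroup E] [NormedSpace 𝕜 E] [NormedAddCommGroup F] [NormedSpace 𝕜 F] :
    Submodule 𝕜 (ContinuousMultilinearMap 𝕜 (fun _ : Fin n => E) F) where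
  carrier := {A | ∀ (σ : Equiv.Perm (Fin n)) (v : Fin n → E), A (v ∘ σ) = A v}
  add_mem' := by intro a b ha hb σ v; simp [ha σ v, hb σ v]
  zero_mem' := by intro σ v; simp
  smul_mem' := by intro c a ha σ v; simp [ha σ v]

/-- The Banach space of continuous `n`-homogeneous polynomials from `E` to `F`. -/
abbrev HomPoly (𝕜 : Type*) [NontriviallyNormedField 𝕜] (n : ℕ) (E F : Type*)
    [NormedAddCommGroup E] [NormedSpace 𝕜 E] [NormedAddCommGroup F] [NormedSpace 𝕜 F] :=
  ↥(SymmCM 𝕜 n E F)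

/-- Evaluation of a homogeneous polynomial on the diagonal. -/
def HomPoly.eval {𝕜 : Type*} [NontriviallyNormedField 𝕜] {n : ℕ} {E F : Type*}
    [NormedAddCommGroup E] [NormedSpace 𝕜 E] [NormedAddCommGroup F] [NormedSpace 𝕜 F]
    (P : HomPoly 𝕜 n E F) (x : E) : F :=
  (P : ContinuousMultilinearMap 𝕜 (fun _ : Fin n => E) F) (fun _ => x)

namespace APC

def dd (k : ℕ) : ℕ := k / 8

abbrev Sy (k : ℕ) : Type := ZMod 2 × ZMod 2 × (Fin (dd k) → ZMod 2)

abbrev Om : Type := ∀ k, Sy k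

def cf {k : ℕ} (c : Sy k) (i : ℕ) : ZMod 2 :=
  if i = 0 then 1 else if i = 1 then c.1 else if i = 2 then c.2.1
  else if h : i - 3 < dd k then c.2.2 ⟨i - 3, h⟩ else 0

def hk (k : ℕ) (c : Sy (k+1)) (a : ℕ → ZMod 2) : Fin (dd k) → ZMod 2 := fun t =>
  ∑ i ∈ Finset.range (3 + dd (k+1)), cf c i * a (k - 2 - 2 * (i + t))

lemma hk_add (k : ℕ) (c : Sy (k+1)) (a b : ℕ → ZMod 2) :
    hk k c (a + b) = hk k c a + hk k c b := by
  ext t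
  simp [hk, mul_add, Finset.sum_add_distrib]

lemma hk_congr (k : ℕ) (c : Sy (k+1)) (a b : ℕ → ZMod 2)
    (h : ∀ j, j + 2 ≤ k → j % 2 = k % 2 → a j = b j) : hk k c a = hk k c b := by
  ext t
  refine Finset.sum_congr rfl fun i hi => ?_
  rw [Finset.mem_range] at hi
  have ht := t.2
  have : k ≥ 8 := by
    by_contra hk
    have : dd k = 0 := by unfold dd; omega
    omega
  unfold dd at ht hi
  rw [h] <;> omega

lemma hk_zero (k : ℕ) (c : Sy (k+1)) : hk k c 0 = 0 := by
  ext t; simp [hk]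

lemma z2 (x : ZMod 2) : x + x = 0 := by revert x; decide

lemma z2f {n : ℕ} (x : Fin n → ZMod 2) : x + x = 0 := by ext i; simp [z2]

def hh (s : Om) : ℕ → ZMod 2 := fun j => (s j).1
def gg (s : Om) : ℕ → ZMod 2 := fun j => (s j).2.1

def ty (M : ℕ) (s : Om) (k : ℕ) : Fin (dd k) → ZMod 2 :=
  (s k).2.2 + if k + 1 < M then hk k (s (k+1)) (hh s) else 0

def lab (M p : ℕ) (s : Om) : Om := fun k => if k % 2 = p then s k else (0, 0, ty M s k)

def act (M q : ℕ) (a b : ℕ → ZMod 2) (s : Om) : Om := fun k =>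
  if k % 2 = q ∧ k < M then ((s k).1 + a k, (s k).2.1 + b k,
    (s k).2.2 + if k + 1 < M then hk k (s (k+1)) a else 0) else s k

lemma act_of_ne {M q : ℕ} {a b : ℕ → ZMod 2} {s : Om} {k : ℕ} (h : k % 2 ≠ q) :
    act M q a b s k = s k := by simp [act, h]

lemma act_succ {M q : ℕ} {a b : ℕ → ZMod 2} {s : Om} {k : ℕ} (h : k % 2 = q) :
    act M q a b s (k+1) = s (k+1) := act_of_ne (by omega)

lemma act_act (M q : ℕ) (a b : ℕ → ZMod 2) (s : Om) :
    act M q a b (act M q a b s) = s := by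
  funext k
  by_cases h : k % 2 = q ∧ k < M
  · have h1 := act_succ (M := M) (a := a) (b := b) (s := s) h.1
    have h2 : ∀ s' : Om, act M q a b s' k = ((s' k).1 + a k, (s' k).2.1 + b k,
      (s' k).2.2 + if k + 1 < M then hk k (s' (k+1)) a else 0) := fun s' => if_pos h
    rw [h2, h1, h2]
    ext1
    · simp [add_assoc, z2]
    ext1
    · simp [add_assoc, z2]
    · simp only [add_assoc, z2f, add_zero]
  · simp only [act, h, if_false]

lemma lab_act {M p q : ℕ} (hpq : p ≠ q) (hp : p < 2) (hq : q < 2) (a b : ℕ → ZMod 2) (s : Om) :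
    lab M p (act M q a b s) = lab M p s := by
  funext k
  by_cases h : k % 2 = p
  · simp only [lab, h, if_true]
    exact act_of_ne (by omega)
  · simp only [lab, h, if_false]
    congr 2
    have hkq : k % 2 = q := by omega
    unfold ty
    rw [act_succ hkq]
    by_cases hkM : k < M
    · by_cases hk1 : k + 1 < M
      · have : hk k (s (k+1)) (hh (act M q a b s)) = hk k (s (k+1)) (hh s + a) := by
          apply hk_congr
          intro j hj hjk
          simp only [hh, Pi.add_apply, act]
          rw [if_pos ⟨by omega, by omega⟩]
        rw [this, hk_add]
        simp only [act, hkq, hkM, and_self, if_true, hk1]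
        rw [show ∀ x y z : Fin (dd k) → ZMod 2, x + y + (z + y) = x + z + (y + y) by
          intros; abel, z2f, add_zero]
      · simp only [hk1, act, hkq, hkM, and_self, if_true, if_false, add_zero]
    · have : ¬ k + 1 < M := by omega
      simp [this, act, hkM]

/-- reconstruct -/
lemma recon {M p : ℕ} {s s' : Om} (hl : lab M p s = lab M p s') {ℓ : ℕ}
    (h1 : ∀ k < ℓ, k % 2 ≠ p → (s k).1 = (s' k).1)
    (h2 : ∀ k < ℓ, k % 2 ≠ p → (s k).2.1 = (s' k).2.1) (hp : p < 2) :
    ∀ k < ℓ, s k = s' k := by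
  intro k hk
  have hlk := congrFun hl k
  by_cases h : k % 2 = p
  · simpa [lab, h] using hlk
  · simp only [lab, h, if_false, ty, Prod.mk.injEq, true_and] at hlk
    ext1
    · exact h1 k hk h
    ext1
    · exact h2 k hk h
    have e1 : s (k+1) = s' (k+1) := by
      have := congrFun hl (k+1)
      simpa [lab, show (k+1) % 2 = p by omega] using this
    rw [e1, hk_congr k (s' (k+1)) (hh s) (hh s') (by
      intro j hj hjk
      exact h1 j (by omega) (by omega))] at hlk
    exact add_right_cancel hlk

lemma lab_inj {M : ℕ} {s s' : Om} (h0 : lab M 0 s = lab M 0 s') (h1 : lab M 1 s = lab M 1 s') :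
    s = s' := by
  funext k
  have a0 := congrFun h0 k
  have a1 := congrFun h1 k
  rcases Nat.mod_two_eq_zero_or_one k with h | h
  · simpa [lab, h] using a0
  · simpa [lab, h] using a1

abbrev EE (M : ℕ) : Type := {s : Om // ∀ k, M ≤ k → s k = 0}

instance (M : ℕ) : Finite (EE M) := by
  apply Finite.of_injective (fun (s : EE M) (k : Fin M) => s.1 k)
  intro s s' h
  ext1
  funext k
  by_cases hk : k < M
  · exact congrFun h ⟨k, hk⟩
  · rw [s.2 k (by omega), s'.2 k (by omega)]

instance (M : ℕ) : Fintype (EE M) := Fintype.ofFinite _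
instance (M : ℕ) : DecidableEq (EE M) := Classical.decEq _

def labE (M p : ℕ) (s : EE M) : EE M := ⟨lab M p s.1, by
  intro k hk
  have h := s.2 k hk
  have : ¬ k + 1 < M := by omega
  simp [lab, ty, this, h]⟩

def actE (M q : ℕ) (a b : ℕ → ZMod 2) (s : EE M) : EE M := ⟨act M q a b s.1, by
  intro k hk
  have h := s.2 k hk
  simp [act, not_lt.2 hk, h]⟩

lemma labE_eq {M p : ℕ} {s s' : EE M} : labE M p s = labE M p s' ↔ lab M p s.1 = lab M p s'.1 := by
  simp [labE]

def sg (x : ZMod 2) : ℤ := if x = 0 then 1 else -1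

lemma sg_add (x y : ZMod 2) : sg (x + y) = sg x * sg y := by revert x y; decide
lemma sg_one : sg 1 = -1 := by decide
lemma sg_sq (x : ZMod 2) : sg x * sg x = 1 := by revert x; decide

def ex (m : ℕ) (s : Om) : ZMod 2 :=
  ∑ i ∈ Finset.range m, (hh s (2*i) * gg s (2*i+1) + gg s (2*i) * hh s (2*i+1))

def th (m : ℕ) (s : Om) : ℤ := sg (ex m s)

lemma ex_act (m : ℕ) (a b : ℕ → ZMod 2) (s : Om) : ex m (act (2*m) 1 a b s) = ex m s +
    ∑ i ∈ Finset.range m, (hh s (2*i) * b (2*i+1) + gg s (2*i) * a (2*i+1)) := by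
  unfold ex
  rw [← Finset.sum_add_distrib]
  refine Finset.sum_congr rfl fun i hi => ?_
  rw [Finset.mem_range] at hi
  have e1 : act (2*m) 1 a b s (2*i) = s (2*i) := act_of_ne (by omega)
  have e2 : hh (act (2*m) 1 a b s) (2*i+1) = hh s (2*i+1) + a (2*i+1) := by
    simp only [hh, act]; rw [if_pos ⟨by omega, by omega⟩]
  have e3 : gg (act (2*m) 1 a b s) (2*i+1) = gg s (2*i+1) + b (2*i+1) := by
    simp only [gg, act]; rw [if_pos ⟨by omega, by omega⟩]
  rw [e2, e3]
  simp only [hh, gg, e1]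
  ring

end APC

namespace APC

def sgl (j : ℕ) : ℕ → ZMod 2 := fun k => if k = j then 1 else 0

def GP (m : ℕ) (u u' : ℕ → ZMod 2 × ZMod 2) (ab : (ℕ → ZMod 2) × (ℕ → ZMod 2)) : Prop :=
  (∃ i, i < m ∧ (u i).1 ≠ (u' i).1 ∧ (∀ i' < i, (u i').1 = (u' i').1) ∧ ab = (0, sgl (2*i+1))) ∨
  ((∀ i, i < m → (u i).1 = (u' i).1) ∧ ∃ i, i < m ∧ (u i).2 ≠ (u' i).2 ∧
    (∀ i', i < i' → i' < m → (u i').2 = (u' i').2) ∧ ab = (sgl (2*i+1), 0))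

def evn (s : Om) : ℕ → ZMod 2 × ZMod 2 := fun i => (hh s (2*i), gg s (2*i))

lemma evn_act (M : ℕ) (a b : ℕ → ZMod 2) (s : Om) : evn (act M 1 a b s) = evn s := by
  funext i
  have : act M 1 a b s (2*i) = s (2*i) := act_of_ne (by omega)
  simp [evn, hh, gg, this]

open Classical in
def chs (m : ℕ) (u u' : ℕ → ZMod 2 × ZMod 2) : (ℕ → ZMod 2) × (ℕ → ZMod 2) :=
  if h : ∃ ab, GP m u u' ab then h.choose else (0, 0)

lemma chs_spec {m : ℕ} {u u' : ℕ → ZMod 2 × ZMod 2} (h : ∃ ab, GP m u u' ab) :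
    GP m u u' (chs m u u') := by
  unfold chs; rw [dif_pos h]; exact h.choose_spec

lemma exists_GP {m : ℕ} {s s' : EE (2*m)} (hne : s ≠ s') (h1 : lab (2*m) 1 s.1 = lab (2*m) 1 s'.1) :
    ∃ ab, GP m (evn s.1) (evn s'.1) ab := by
  classical
  by_cases hA : ∃ i, i < m ∧ (evn s.1 i).1 ≠ (evn s'.1 i).1
  · let i := Nat.find hA
    have hi := Nat.find_spec hA
    refine ⟨_, Or.inl ⟨i, hi.1, hi.2, ?_, rfl⟩⟩
    intro i' hi'
    have := Nat.find_min hA hi'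
    by_contra hc
    exact this ⟨lt_trans hi' hi.1, hc⟩
  · push Not at hA
    by_cases hB : ∃ i, i < m ∧ (evn s.1 i).2 ≠ (evn s'.1 i).2
    · obtain ⟨i, hi, hi'⟩ : ∃ i, (i < m ∧ (evn s.1 i).2 ≠ (evn s'.1 i).2) ∧ ∀ i' < m,
          (evn s.1 i').2 ≠ (evn s'.1 i').2 → i' ≤ i := by
        let F := (Finset.range m).filter fun i => (evn s.1 i).2 ≠ (evn s'.1 i).2
        have hF : F.Nonempty := by
          obtain ⟨i, hi⟩ := hB
          exact ⟨i, by simpa [F] using hi⟩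
        refine ⟨F.max' hF, ?_, ?_⟩
        · have := F.max'_mem hF
          simpa [F] using this
        · intro i' h1 h2
          exact F.le_max' _ (by simpa [F] using ⟨h1, h2⟩)
      refine ⟨_, Or.inr ⟨hA, i, hi.1, hi.2, ?_, rfl⟩⟩
      intro i' h1 h2
      by_contra hc
      have := hi' i' h2 hc
      omega
    · push Not at hB
      exfalso
      apply hne
      ext1
      have := recon (ℓ := 2*m) h1 (by
        intro k hk hk2
        have e : k = 2*(k/2) := by omega
        rw [e]
        exact hA _ (by omega)) (by
        intro k hk hk2
        have e : k = 2*(k/2) := by omega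
        rw [e]
        exact hB _ (by omega)) (by norm_num)
      funext k
      by_cases hk : k < 2*m
      · exact this k hk
      · rw [s.2 k (by omega), s'.2 k (by omega)]

lemma sum_sgl (m i : ℕ) (hi : i < m) (f : ℕ → ZMod 2) :
    ∑ j ∈ Finset.range m, f j * sgl (2*i+1) (2*j+1) = f i := by
  rw [Finset.sum_eq_single i]
  · simp [sgl]
  · intro j _ hj
    simp [sgl, hj]
  · intro h; simp at h; omega

lemma z2ne {x y : ZMod 2} (h : x ≠ y) : x + y = 1 := by revert x y; decide

/-- key properties of good move -/
lemma GP_spec {m : ℕ} {s s' : EE (2*m)} (h1 : lab (2*m) 1 s.1 = lab (2*m) 1 s'.1)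
    {ab} (h : GP m (evn s.1) (evn s'.1) ab) {ℓ : ℕ} {b : Om}
    (hb : ∀ k < ℓ, s.1 k = b k) (hb' : ∀ k < ℓ, s'.1 k = b k) :
    lab (2*m) 1 (act (2*m) 1 ab.1 ab.2 s.1) = lab (2*m) 1 (act (2*m) 1 ab.1 ab.2 s'.1) ∧
    (∀ k < ℓ, act (2*m) 1 ab.1 ab.2 s.1 k = b k) ∧
    (∀ k < ℓ, act (2*m) 1 ab.1 ab.2 s'.1 k = b k) ∧
    th m (act (2*m) 1 ab.1 ab.2 s.1) * th m (act (2*m) 1 ab.1 ab.2 s'.1) =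
      - (th m s.1 * th m s'.1) := by
  have hodd : ∀ k, k % 2 = 1 → s.1 k = s'.1 k := by
    intro k hk
    have := congrFun h1 k
    simpa [lab, hk] using this
  -- prefix preserved if ab vanishes below ℓ
  have hpre : (∀ j < ℓ, ab.1 j = 0) → (∀ j < ℓ, ab.2 j = 0) → ∀ s : Om, (∀ k < ℓ, s k = b k) →
      ∀ k < ℓ, act (2*m) 1 ab.1 ab.2 s k = b k := by
    intro ha hb2 s hs k hk
    rw [← hs k hk]
    unfold act
    split_ifs with hc hc2
    · rw [hk_congr k _ ab.1 0 (fun j hj _ => ha j (by omega)), hk_zero]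
      simp [ha k hk, hb2 k hk]
    · simp [ha k hk, hb2 k hk]
    · rfl
  have hth : ∀ x y : Om, sg (∑ i ∈ Finset.range m, (hh x (2*i) * ab.2 (2*i+1) + gg x (2*i) * ab.1 (2*i+1)))
      * sg (∑ i ∈ Finset.range m, (hh y (2*i) * ab.2 (2*i+1) + gg y (2*i) * ab.1 (2*i+1))) = -1 →
      th m (act (2*m) 1 ab.1 ab.2 x) * th m (act (2*m) 1 ab.1 ab.2 y) = - (th m x * th m y) := by
    intro x y hxy
    unfold th
    rw [ex_act, ex_act, sg_add, sg_add, mul_mul_mul_comm, hxy]; ring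
  rcases h with ⟨i, him, hne, hmin, rfl⟩ | ⟨hA, i, him, hne, hmax, rfl⟩
  · have hℓ : ℓ ≤ 2*i := by
      by_contra hc
      apply hne
      simp [evn, hh, hb _ (not_le.1 hc), hb' _ (not_le.1 hc)]
    have hv : ∀ j < ℓ, sgl (2*i+1) j = 0 := by
      intro j hj
      simp only [sgl]
      rw [if_neg (by omega)]
    refine ⟨?_, hpre (fun _ _ => rfl) hv _ hb, hpre (fun _ _ => rfl) hv _ hb', hth _ _ ?_⟩
    · funext k
      rcases Nat.mod_two_eq_zero_or_one k with hk | hk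
      · simp only [lab, hk, zero_ne_one, if_false]
        congr 2
        have hlk := congrFun h1 k
        simp only [lab, hk, ty, Prod.mk.injEq, true_and, zero_ne_one, if_false] at hlk
        unfold ty
        have hev : ∀ x : Om, ∀ k, k % 2 = 0 → act (2*m) 1 0 (sgl (2*i+1)) x k = x k :=
          fun x k hk => act_of_ne (by omega)
        have hhv : ∀ x : Om, ∀ c, APC.hk k c (hh (act (2*m) 1 0 (sgl (2*i+1)) x)) = APC.hk k c (hh x) := by
          intro x c
          apply hk_congr
          intro j hj hjk
          simp only [hh]; rw [hev x j (by omega)]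
        simp only [hhv, hev _ k hk]
        by_cases hki : k = 2*i
        · have hss : ∀ c, APC.hk k c (hh s.1) = APC.hk k c (hh s'.1) := by
            intro c
            apply hk_congr
            intro j hj hjk
            have := hmin (j/2) (by omega)
            simpa [evn, show 2*(j/2) = j by omega] using this
          have e : act (2*m) 1 0 (sgl (2*i+1)) s.1 (k+1) = act (2*m) 1 0 (sgl (2*i+1)) s'.1 (k+1) := by
            simp only [act, hodd (k+1) (by omega)]
            split_ifs with _ hc
            · rw [hk_zero, hk_zero]
            · rfl
            · rfl
          rw [e, hss]
          congr 1
          rw [hodd (k+1) (by omega), hss] at hlk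
          exact add_right_cancel hlk
        · have e : ∀ x, act (2*m) 1 0 (sgl (2*i+1)) x (k+1) = x (k+1) := by
            intro x
            simp only [act]
            split_ifs with _ hc
            · rw [hk_zero]; simp [sgl, hki]
            · simp [sgl, hki]
            · rfl
          rw [e, e]; exact hlk
      · simp only [lab, hk, if_true, act, hodd k hk]
        congr 3
    · simp only [Pi.zero_apply, mul_zero, add_zero]
      rw [sum_sgl m i him (fun i => hh s.1 (2*i)), sum_sgl m i him (fun i => hh s'.1 (2*i)), ← sg_add]
      exact (congrArg sg (z2ne hne)).trans sg_one
  · have hℓ : ℓ ≤ 2*i := by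
      by_contra hc
      apply hne
      simp [evn, gg, hb _ (not_le.1 hc), hb' _ (not_le.1 hc)]
    have hv : ∀ j < ℓ, sgl (2*i+1) j = 0 := by
      intro j hj
      simp only [sgl]
      rw [if_neg (by omega)]
    refine ⟨?_, hpre hv (fun _ _ => rfl) _ hb, hpre hv (fun _ _ => rfl) _ hb', hth _ _ ?_⟩
    · -- even h equal
      have hh0 : ∀ k, k % 2 = 0 → hh s.1 k = hh s'.1 k := by
        intro k hk
        by_cases hkm : k < 2*m
        · have := hA (k/2) (by omega)
          simpa [evn, show 2*(k/2) = k by omega] using this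
        · simp [hh, s.2 k (by omega), s'.2 k (by omega)]
      have hy0 : ∀ k, k % 2 = 0 → (s.1 k).2.2 = (s'.1 k).2.2 := by
        intro k hk
        have hlk := congrFun h1 k
        simp only [lab, hk, ty, Prod.mk.injEq, true_and, zero_ne_one, if_false] at hlk
        rw [hodd (k+1) (by omega), hk_congr k _ (hh s.1) (hh s'.1) (fun j _ hj => hh0 j (by omega))]
          at hlk
        exact add_right_cancel hlk
      have hs0 : ∀ k, k % 2 = 0 → 2*i < k → s.1 k = s'.1 k := by
        intro k hk hik
        ext1
        · exact hh0 k hk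
        ext1
        · by_cases hkm : k < 2*m
          · have := hmax (k/2) (by omega) (by omega)
            have e : 2*(k/2) = k := by omega
            simp only [evn, e] at this
            exact this
          · simp [s.2 k (by omega), s'.2 k (by omega)]
        · exact hy0 k hk
      have hodd' : ∀ k, k % 2 = 1 → act (2*m) 1 (sgl (2*i+1)) 0 s.1 k =
          act (2*m) 1 (sgl (2*i+1)) 0 s'.1 k := by
        intro k hk
        simp only [act, hodd k hk]
        by_cases hki : 2*i < k+1
        · rw [hs0 (k+1) (by omega) hki]
        · have : ∀ c, APC.hk k c (sgl (2*i+1)) = 0 := by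
            intro c
            rw [hk_congr k c (sgl (2*i+1)) 0, hk_zero]
            intro j hj _
            simp only [sgl]
            rw [if_neg (by omega)]; rfl
          rw [this, this]
      funext k
      rcases Nat.mod_two_eq_zero_or_one k with hk | hk
      · simp only [lab, hk, zero_ne_one, if_false]
        congr 2
        unfold ty
        have hev : ∀ x : Om, ∀ k, k % 2 = 0 → act (2*m) 1 (sgl (2*i+1)) 0 x k = x k :=
          fun x k hk => act_of_ne (by omega)
        have hhv : ∀ x : Om, ∀ c, APC.hk k c (hh (act (2*m) 1 (sgl (2*i+1)) 0 x)) =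
            APC.hk k c (hh x) := by
          intro x c
          apply hk_congr
          intro j hj hjk
          simp only [hh]; rw [hev x j (by omega)]
        rw [hhv, hhv, hev _ _ hk, hev _ _ hk, hodd' (k+1) (by omega), hy0 k hk,
          hk_congr k _ (hh s.1) (hh s'.1) (fun j _ hj => hh0 j (by omega))]
      · simp only [lab, hk, if_true]
        exact hodd' k hk
    · simp only [Pi.zero_apply, mul_zero, zero_add]
      rw [sum_sgl m i him (fun i => gg s.1 (2*i)), sum_sgl m i him (fun i => gg s'.1 (2*i)), ← sg_add]
      exact (congrArg sg (z2ne hne)).trans sg_one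

end APC

namespace APC

open Classical in
def cyl (M ℓ : ℕ) (b : Om) : Finset (EE M) := Finset.univ.filter fun e => ∀ k < ℓ, e.1 k = b k

lemma mem_cyl {M ℓ : ℕ} {b : Om} {e : EE M} : e ∈ cyl M ℓ b ↔ ∀ k < ℓ, e.1 k = b k := by
  simp [cyl]

variable {𝕜 : Type*} [RCLike 𝕜]

lemma cancel (m ℓ : ℕ) (b : Om) (φ : EE (2*m) → 𝕜) :
    ∑ x ∈ ((cyl (2*m) ℓ b) ×ˢ (cyl (2*m) ℓ b)).filter
      (fun x => labE (2*m) 1 x.1 = labE (2*m) 1 x.2 ∧ x.1 ≠ x.2),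
      ((th m x.1.1 * th m x.2.1 : ℤ) : 𝕜) * (φ (labE (2*m) 0 x.1) * star (φ (labE (2*m) 0 x.2))) = 0 := by
  classical
  let C : EE (2*m) × EE (2*m) → (ℕ → ZMod 2) × (ℕ → ZMod 2) :=
    fun x => chs m (evn x.1.1) (evn x.2.1)
  let g : EE (2*m) × EE (2*m) → EE (2*m) × EE (2*m) := fun x =>
    (actE (2*m) 1 (C x).1 (C x).2 x.1, actE (2*m) 1 (C x).1 (C x).2 x.2)
  have hC : ∀ x, C (g x) = C x := by
    intro x
    simp only [C, g, actE, evn_act]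
  have hgg : ∀ x, g (g x) = x := by
    intro x
    have : g (g x) = (actE (2*m) 1 (C x).1 (C x).2 (g x).1, actE (2*m) 1 (C x).1 (C x).2 (g x).2) := by
      conv_lhs => rw [show g (g x) = (actE (2*m) 1 (C (g x)).1 (C (g x)).2 (g x).1,
        actE (2*m) 1 (C (g x)).1 (C (g x)).2 (g x).2) from rfl, hC]
    rw [this]
    ext1 <;> ext1 <;> exact act_act _ _ _ _ _
  have hlab : ∀ x : EE (2*m) × EE (2*m), labE (2*m) 0 (g x).1 = labE (2*m) 0 x.1 ∧
      labE (2*m) 0 (g x).2 = labE (2*m) 0 x.2 := by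
    intro x
    constructor <;> rw [labE_eq] <;>
    exact lab_act (by norm_num) (by norm_num) (by norm_num) _ _ _
  have key : ∀ x : EE (2*m) × EE (2*m), x ∈ ((cyl (2*m) ℓ b) ×ˢ (cyl (2*m) ℓ b)).filter
      (fun x => labE (2*m) 1 x.1 = labE (2*m) 1 x.2 ∧ x.1 ≠ x.2) →
      g x ∈ ((cyl (2*m) ℓ b) ×ˢ (cyl (2*m) ℓ b)).filter
      (fun x => labE (2*m) 1 x.1 = labE (2*m) 1 x.2 ∧ x.1 ≠ x.2) ∧
      th m (g x).1.1 * th m (g x).2.1 = - (th m x.1.1 * th m x.2.1) := by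
    intro x hx
    simp only [Finset.mem_filter, Finset.mem_product, mem_cyl] at hx
    obtain ⟨⟨h1, h2⟩, h3, h4⟩ := hx
    obtain ⟨q1, q2, q3, q4⟩ := GP_spec (labE_eq.1 h3) (chs_spec (exists_GP h4 (labE_eq.1 h3))) h1 h2
    refine ⟨?_, q4⟩
    simp only [Finset.mem_filter, Finset.mem_product, mem_cyl]
    refine ⟨⟨q2, q3⟩, labE_eq.2 q1, ?_⟩
    intro h
    apply h4
    have e := hgg x
    have : ∀ y : EE (2*m) × EE (2*m), y.1 = y.2 → (g y).1 = (g y).2 := by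
      intro y hy; simp only [g, hy]
    have := this _ h
    rwa [e] at this
  refine Finset.sum_involution (fun x _ => g x) ?_ ?_ (fun x hx => (key x hx).1) (fun x _ => hgg x)
  · intro x hx
    rw [(key x hx).2, (hlab x).1, (hlab x).2]
    push_cast; ring
  · intro x hx hne h
    apply hne
    have := (key x hx).2
    rw [h] at this
    have : th m x.1.1 * th m x.2.1 = 0 := by linarith
    rw [this]; simp

lemma th_sq (m : ℕ) (s : Om) : th m s * th m s = 1 := sg_sq _

lemma gram (m ℓ : ℕ) (b : Om) (φ : EE (2*m) → 𝕜) :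
    ∑ κ, ‖∑ s ∈ cyl (2*m) ℓ b, if labE (2*m) 1 s = κ then
      ((th m s.1 : ℤ) : 𝕜) * φ (labE (2*m) 0 s) else 0‖^2 =
    ∑ s ∈ cyl (2*m) ℓ b, ‖φ (labE (2*m) 0 s)‖^2 := by
  classical
  have hcast : ∀ x : ℝ, ∀ y : ℝ, ((x : 𝕜) = (y : 𝕜)) → x = y := fun x y h => by exact_mod_cast h
  apply hcast
  push_cast
  simp only [← RCLike.mul_conj, map_sum, apply_ite (starRingEnd 𝕜), map_zero, map_mul, map_intCast]
  have e1 : ∀ κ : EE (2*m), (∑ s ∈ cyl (2*m) ℓ b, if labE (2*m) 1 s = κ then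
      ((th m s.1 : ℤ) : 𝕜) * φ (labE (2*m) 0 s) else 0) * (∑ s ∈ cyl (2*m) ℓ b, if labE (2*m) 1 s = κ then
      ((th m s.1 : ℤ) : 𝕜) * (starRingEnd 𝕜) (φ (labE (2*m) 0 s)) else 0) =
      ∑ x ∈ (cyl (2*m) ℓ b) ×ˢ (cyl (2*m) ℓ b), if labE (2*m) 1 x.1 = κ then (if labE (2*m) 1 x.1 = labE (2*m) 1 x.2 then
      ((th m x.1.1 * th m x.2.1 : ℤ) : 𝕜) * (φ (labE (2*m) 0 x.1) * star (φ (labE (2*m) 0 x.2))) else 0) else 0 := by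
    intro κ
    rw [Finset.sum_mul_sum, ← Finset.sum_product']
    refine Finset.sum_congr rfl fun x _ => ?_
    by_cases h1 : labE (2*m) 1 x.1 = κ
    · by_cases h2 : labE (2*m) 1 x.2 = κ
      · simp only [h1, h2, if_true]; push_cast; 
        rw [starRingEnd_apply]; ring
      · simp [h1, h2, Ne.symm h2]
    · simp [h1]
  simp only [e1]
  rw [Finset.sum_comm]
  simp only [Finset.sum_ite_eq, Finset.mem_univ, if_true]
  rw [← Finset.sum_filter]
  have := cancel m ℓ b φ
  rw [← Finset.sum_filter_add_sum_filter_not _ (fun x => x.1 = x.2), Finset.filter_filter, Finset.filter_filter,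
    this, add_zero]
  symm
  refine Finset.sum_bij (fun s _ => (s, s)) ?_ ?_ ?_ ?_
  · intro s hs; simp [hs]
  · intro s _ s' _ h; simpa using h
  · rintro ⟨x, y⟩ h
    simp only [Finset.mem_filter, Finset.mem_product] at h
    exact ⟨x, h.1.1, by ext1 <;> simp [h.2.2]⟩
  · intro s hs
    rw [th_sq, Int.cast_one, one_mul]; rfl

/-- tail count -/
lemma tail_count (m ℓ : ℕ) (b : Om) (ρ : EE (2*m)) :
    ((cyl (2*m) ℓ b).filter fun e => labE (2*m) 0 e = ρ).card ≤ 4^(m - ℓ/2) := by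
  classical
  have : Fintype.card (Fin (m - ℓ/2) → ZMod 2 × ZMod 2) = 4^(m-ℓ/2) := by
    simp
  rw [← this, ← Finset.card_univ]
  apply Finset.card_le_card_of_injOn (fun (e : EE (2*m)) (r : Fin (m - ℓ/2)) => (hh e.1 (2*(ℓ/2+r)+1), gg e.1 (2*(ℓ/2+r)+1)))
    (fun _ _ => Finset.mem_coe.2 (Finset.mem_univ _))
  intro e he e' he' h
  simp only [Finset.coe_filter, Set.mem_setOf_eq, mem_cyl] at he he'
  have hl : lab (2*m) 0 e.1 = lab (2*m) 0 e'.1 := labE_eq.1 (he.2.trans he'.2.symm)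
  have hr : ∀ k < 2*m, k % 2 ≠ 0 → (e.1 k).1 = (e'.1 k).1 ∧ (e.1 k).2.1 = (e'.1 k).2.1 := by
    intro k hk hk2
    by_cases hkl : k < ℓ
    · rw [he.1 k hkl, he'.1 k hkl]; exact ⟨rfl, rfl⟩
    · have h' := congrFun h ⟨k/2 - ℓ/2, by omega⟩
      simp only [Prod.mk.injEq, show 2*(ℓ/2+(k/2-ℓ/2))+1 = k by omega] at h'
      exact h'
  have := recon (ℓ := 2*m) hl (fun k hk h2 => (hr k hk h2).1) (fun k hk h2 => (hr k hk h2).2) (by norm_num)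
  ext1
  funext k
  by_cases hk : k < 2*m
  · exact this k hk
  · rw [e.2 k (by omega), e'.2 k (by omega)]

open Classical in
/-- the operator with coefficients `c` -/
def opl (m : ℕ) (c : EE (2*m) → 𝕜) :
    EuclideanSpace 𝕜 (EE (2*m)) →ₗ[𝕜] EuclideanSpace 𝕜 (EE (2*m)) where
  toFun φ := WithLp.toLp 2 fun κ => ∑ s, if labE (2*m) 1 s = κ then
      c s * (((th m s.1 : ℤ) : 𝕜) * φ (labE (2*m) 0 s)) else 0
  map_add' φ ψ := by
    ext κ
    simp only [PiLp.add_apply, ← Finset.sum_add_distrib]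
    refine Finset.sum_congr rfl fun s _ => ?_
    split_ifs <;> ring
  map_smul' a φ := by
    ext κ
    simp only [PiLp.smul_apply, smul_eq_mul, RingHom.id_apply, Finset.mul_sum]
    refine Finset.sum_congr rfl fun s _ => ?_
    split_ifs <;> ring

def op (m : ℕ) (c : EE (2*m) → 𝕜) :
    EuclideanSpace 𝕜 (EE (2*m)) →L[𝕜] EuclideanSpace 𝕜 (EE (2*m)) :=
  LinearMap.toContinuousLinearMap (opl m c)

lemma op_apply (m : ℕ) (c : EE (2*m) → 𝕜) (φ : EuclideanSpace 𝕜 (EE (2*m))) (κ) :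
    op m c φ κ = ∑ s, if labE (2*m) 1 s = κ then
      c s * (((th m s.1 : ℤ) : 𝕜) * φ (labE (2*m) 0 s)) else 0 := by
  classical
  simp only [op, LinearMap.coe_toContinuousLinearMap', opl, LinearMap.coe_mk, AddHom.coe_mk]

open Classical in
def ind (M ℓ : ℕ) (b : Om) (e : EE M) : 𝕜 := if ∀ k < ℓ, e.1 k = b k then 1 else 0

open Classical in
lemma norm_op_le (m ℓ : ℕ) {J : Type*} [Fintype J] (b : J → Om) (ε : J → 𝕜) (hε : ∀ j, ‖ε j‖ ≤ 1)
    (c0 c1 : ℕ)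
    (h0 : ∀ ρ, (Finset.univ.filter fun j => ∃ e ∈ cyl (2*m) ℓ (b j), labE (2*m) 0 e = ρ).card ≤ c0)
    (h1 : ∀ ρ, (Finset.univ.filter fun j => ∃ e ∈ cyl (2*m) ℓ (b j), labE (2*m) 1 e = ρ).card ≤ c1) :
    ‖op m (fun e => ∑ j, ε j * ind (2*m) ℓ (b j) e)‖^2 ≤ c0 * c1 * 4^(m-ℓ/2) := by
  have hnn : (0:ℝ) ≤ c0 * c1 * 4^(m-ℓ/2) := by positivity
  suffices ‖op m (fun e => ∑ j, ε j * ind (2*m) ℓ (b j) e)‖ ≤ √(c0 * c1 * 4^(m-ℓ/2)) by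
    calc _ ≤ (√(c0 * c1 * 4^(m-ℓ/2) : ℝ))^2 := by gcongr
      _ = _ := Real.sq_sqrt hnn
  refine ContinuousLinearMap.opNorm_le_bound _ (Real.sqrt_nonneg _) fun φ => ?_
  rw [← Real.sqrt_sq (norm_nonneg φ), ← Real.sqrt_mul hnn]
  apply Real.le_sqrt_of_sq_le
  rw [EuclideanSpace.norm_sq_eq, EuclideanSpace.norm_sq_eq]
  set X : J → EE (2*m) → 𝕜 := fun j κ => ∑ s ∈ cyl (2*m) ℓ (b j), if labE (2*m) 1 s = κ then
      ((th m s.1 : ℤ) : 𝕜) * φ (labE (2*m) 0 s) else 0 with hX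
  have e1 : ∀ κ, op m (fun e => ∑ j, ε j * ind (2*m) ℓ (b j) e) φ κ = ∑ j, ε j * X j κ := by
    intro κ
    rw [op_apply]
    simp only [hX, Finset.sum_mul, Finset.mul_sum, cyl, Finset.sum_filter]
    rw [Finset.sum_comm]
    refine Finset.sum_congr rfl fun s _ => ?_
    by_cases h : labE (2*m) 1 s = κ
    · simp only [h, if_true]
      refine Finset.sum_congr rfl fun j _ => ?_
      simp only [ind]
      split_ifs <;> simp
    · simp [h]
  have e2 : ∀ κ, ‖∑ j, ε j * X j κ‖^2 ≤ c1 * ∑ j, ‖X j κ‖^2 := by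
    intro κ
    set F := (Finset.univ.filter fun j => ∃ e ∈ cyl (2*m) ℓ (b j), labE (2*m) 1 e = κ) with hF
    have hz : ∀ j, j ∉ F → X j κ = 0 := by
      intro j hj
      simp only [hX]
      refine Finset.sum_eq_zero fun s hs => ?_
      rw [if_neg]
      intro h
      apply hj
      simp only [hF, Finset.mem_filter, Finset.mem_univ, true_and]
      exact ⟨s, hs, h⟩
    have : ∑ j, ε j * X j κ = ∑ j ∈ F, ε j * X j κ := by
      symm
      apply Finset.sum_subset (Finset.subset_univ _)
      intro j _ hj
      rw [hz j hj, mul_zero]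
    rw [this]
    calc ‖∑ j ∈ F, ε j * X j κ‖^2 ≤ (∑ j ∈ F, ‖X j κ‖)^2 := by
          gcongr
          refine (norm_sum_le _ _).trans (Finset.sum_le_sum fun j _ => ?_)
          rw [norm_mul]
          exact mul_le_of_le_one_left (norm_nonneg _) (hε j)
      _ ≤ F.card * ∑ j ∈ F, ‖X j κ‖^2 := sq_sum_le_card_mul_sum_sq
      _ ≤ c1 * ∑ j, ‖X j κ‖^2 := by
          gcongr
          · exact h1 κ
          · exact Finset.subset_univ _
  simp only [e1]
  calc ∑ κ, ‖∑ j, ε j * X j κ‖^2 ≤ ∑ κ, c1 * ∑ j, ‖X j κ‖^2 := Finset.sum_le_sum fun κ _ => e2 κ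
    _ = c1 * ∑ j, ∑ κ, ‖X j κ‖^2 := by rw [← Finset.mul_sum, Finset.sum_comm]
    _ = c1 * ∑ j, ∑ s ∈ cyl (2*m) ℓ (b j), ‖φ (labE (2*m) 0 s)‖^2 := by
      congr 1
      refine Finset.sum_congr rfl fun j _ => ?_
      have := gram m ℓ (b j) (φ : EE (2*m) → 𝕜)
      exact this
    _ = c1 * ∑ j, ∑ ρ, (((cyl (2*m) ℓ (b j)).filter fun e => labE (2*m) 0 e = ρ).card : ℝ) * ‖φ ρ‖^2 := by
      congr 1
      refine Finset.sum_congr rfl fun j _ => ?_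
      rw [← Finset.sum_fiberwise (cyl (2*m) ℓ (b j)) (fun e => labE (2*m) 0 e)]
      refine Finset.sum_congr rfl fun ρ _ => ?_
      rw [Finset.sum_congr rfl (g := fun _ => ‖φ ρ‖^2)]
      · simp
      · intro e he
        rw [(Finset.mem_filter.1 he).2]
    _ = c1 * ∑ ρ, (∑ j, (((cyl (2*m) ℓ (b j)).filter fun e => labE (2*m) 0 e = ρ).card : ℝ)) * ‖φ ρ‖^2 := by
      rw [Finset.sum_comm]; simp only [Finset.sum_mul]
    _ ≤ c1 * ∑ ρ, (c0 * 4^(m-ℓ/2)) * ‖φ ρ‖^2 := by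
      gcongr with ρ _
      set F := (Finset.univ.filter fun j => ∃ e ∈ cyl (2*m) ℓ (b j), labE (2*m) 0 e = ρ) with hF
      have : ∑ j, (((cyl (2*m) ℓ (b j)).filter fun e => labE (2*m) 0 e = ρ).card : ℝ) =
          ∑ j ∈ F, (((cyl (2*m) ℓ (b j)).filter fun e => labE (2*m) 0 e = ρ).card : ℝ) := by
        symm
        apply Finset.sum_subset (Finset.subset_univ _)
        intro j _ hj
        rw [Nat.cast_eq_zero, Finset.card_eq_zero, Finset.filter_eq_empty_iff]
        intro e he h
        apply hj
        simp only [hF, Finset.mem_filter, Finset.mem_univ, true_and]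
        exact ⟨e, he, h⟩
      rw [this]
      calc _ ≤ ∑ j ∈ F, (4:ℝ)^(m-ℓ/2) := by
            refine Finset.sum_le_sum fun j _ => ?_
            exact_mod_cast tail_count m ℓ (b j) ρ
        _ = F.card * 4^(m-ℓ/2) := by simp
        _ ≤ c0 * 4^(m-ℓ/2) := by gcongr; exact h0 ρ
    _ = _ := by rw [← Finset.mul_sum]; ring

end APC

namespace APC

def xt {B : ℕ} (l : Fin B → ZMod 2) (j : ℕ) : ZMod 2 := if h : j < B then l ⟨j, h⟩ else 0

open Classical in
lemma fib (B D N I : ℕ) (hID : D = 0 ∨ I + D ≤ B) (hIN : I < N) (co : ℕ → ZMod 2) (hI : co I ≠ 0)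
    (hN : ∀ i, I < i → i < N → co i = 0) (w : Fin D → ZMod 2) :
    (Finset.univ.filter fun l : Fin B → ZMod 2 =>
      ∀ t : Fin D, ∑ i ∈ Finset.range N, co i * xt l (i + t) = w t).card ≤ 2^(B-D) := by
  have hc : Fintype.card (Fin (B-D) → ZMod 2) = 2^(B-D) := by simp
  rw [← hc, ← Finset.card_univ]
  apply Finset.card_le_card_of_injOn (fun (l : Fin B → ZMod 2) (j : Fin (B-D)) =>
    xt l (if j.1 < I then j.1 else j.1 + D)) (fun _ _ => Finset.mem_coe.2 (Finset.mem_univ _))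
  intro l hl l' hl' h
  simp only [Finset.coe_filter, Finset.mem_univ, true_and, Set.mem_ofPred_eq] at hl hl'
  have hIc : co I = 1 := by
    revert hI; generalize co I = x; revert x; decide
  have hout : ∀ j, j < I ∨ I + D ≤ j → xt l j = xt l' j := by
    intro j hj
    by_cases hjB : j < B
    · rcases hj with hj | hj
      · rcases hID with hD | hD
        · have := congrFun h ⟨j, by omega⟩
          simpa [hj] using this
        · have := congrFun h ⟨j, by omega⟩
          simpa [hj] using this
      · have := congrFun h ⟨j - D, by omega⟩
        simp only [show ¬ (j - D < I) by omega, if_false, show j - D + D = j by omega] at this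
        exact this
    · simp [xt, hjB]
  have hall : ∀ j, xt l j = xt l' j := by
    intro j
    induction j using Nat.strong_induction_on with
    | _ j ih =>
      by_cases hj : j < I ∨ I + D ≤ j
      · exact hout j hj
      · have e := (hl ⟨j - I, by omega⟩).trans (hl' ⟨j - I, by omega⟩).symm
        simp only at e
        rw [← Finset.add_sum_erase _ _ (Finset.mem_range.2 hIN),
          ← Finset.add_sum_erase (Finset.range N) (fun i => co i * xt l' (i + (j - I))) (Finset.mem_range.2 hIN)] at e
        rw [Finset.sum_congr rfl (g := fun i => co i * xt l' (i + (j - I)))] at e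
        · have := add_right_cancel e
          simpa [hIc, show I + (j - I) = j by omega] using this
        · intro i hi
          rw [Finset.mem_erase, Finset.mem_range] at hi
          by_cases hiI : i < I
          · rw [ih _ (by omega)]
          · rw [hN i (by omega) hi.2]; simp
  funext j
  have := hall j
  simpa [xt] using this

def al (k : ℕ) (l : Fin (k/2) → ZMod 2) : ℕ → ZMod 2 := fun j =>
  if j + 2 ≤ k then xt l ((k - 2 - j)/2) else 0

lemma hk_al (k : ℕ) (c : Sy (k+1)) (l : Fin (k/2) → ZMod 2) (t : Fin (dd k)) :
    hk k c (al k l) t = ∑ i ∈ Finset.range (3 + dd (k+1)), cf c i * xt l (i + t) := by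
  unfold hk
  refine Finset.sum_congr rfl fun i hi => ?_
  rw [Finset.mem_range] at hi
  have ht := t.2
  have : k ≥ 8 := by
    by_contra hk
    have : dd k = 0 := by unfold dd; omega
    omega
  unfold dd at ht hi
  unfold al
  rw [if_pos (by omega)]
  congr 2
  omega

lemma top_exists (N : ℕ) (co : ℕ → ZMod 2) (h : ∃ i < N, co i ≠ 0) :
    ∃ I < N, co I ≠ 0 ∧ ∀ i, I < i → i < N → co i = 0 := by
  let F := (Finset.range N).filter fun i => co i ≠ 0
  have hF : F.Nonempty := by
    obtain ⟨i, hi⟩ := h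
    exact ⟨i, by simpa [F] using hi⟩
  have hm := F.max'_mem hF
  simp only [F, Finset.mem_filter, Finset.mem_range] at hm
  refine ⟨F.max' hF, hm.1, hm.2, fun i h1 h2 => ?_⟩
  by_contra hc
  have := F.le_max' i (by simpa [F] using ⟨h2, hc⟩)
  omega

lemma dims (k I : ℕ) (hI : I < 3 + dd (k+1)) : dd k = 0 ∨ I + dd k ≤ k/2 := by
  unfold dd at *; omega

open Classical in
lemma fib1 (k : ℕ) (c : Sy (k+1)) (w : Fin (dd k) → ZMod 2) :
    (Finset.univ.filter fun l : Fin (k/2) → ZMod 2 => hk k c (al k l) = w).card ≤ 2^(k/2 - dd k) := by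
  obtain ⟨I, hI, h1, h2⟩ := top_exists (3 + dd (k+1)) (cf c) ⟨0, by omega, by simp [cf]⟩
  refine le_trans (Finset.card_le_card ?_) (fib (k/2) (dd k) _ I (dims k I hI) hI (cf c) h1 h2 w)
  intro l
  simp only [Finset.mem_filter, Finset.mem_univ, true_and]
  intro h t
  rw [← hk_al, h]

lemma cf_inj {k : ℕ} {c c' : Sy k} (h : ∀ i < 3 + dd k, cf c i = cf c' i) : c = c' := by
  ext1
  · simpa [cf] using h 1 (by omega)
  ext1
  · simpa [cf] using h 2 (by omega)
  funext t
  have := h (t + 3) (by omega)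
  simpa [cf] using this

open Classical in
lemma fib2 (k : ℕ) (c c' : Sy (k+1)) (hc : c ≠ c') (w : Fin (dd k) → ZMod 2) :
    (Finset.univ.filter fun l : Fin (k/2) → ZMod 2 =>
      hk k c (al k l) + hk k c' (al k l) = w).card ≤ 2^(k/2 - dd k) := by
  obtain ⟨I, hI, h1, h2⟩ := top_exists (3 + dd (k+1)) (fun i => cf c i + cf c' i) (by
    by_contra hcon
    push Not at hcon
    apply hc
    apply cf_inj
    intro i hi
    have := hcon i hi
    have e : ∀ x y : ZMod 2, x + y = 0 → x = y := by decide
    exact e _ _ this)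
  refine le_trans (Finset.card_le_card ?_) (fib (k/2) (dd k) _ I (dims k I hI) hI _ h1 h2 w)
  intro l
  simp only [Finset.mem_filter, Finset.mem_univ, true_and]
  intro h t
  simp only [add_mul, Finset.sum_add_distrib]
  rw [← hk_al, ← hk_al, ← h]; rfl

abbrev La (k : ℕ) : Type := Fin (k/2) → ZMod 2

def mv (k : ℕ) (l : La k) (i : Om) : Om := act (k+2) (k%2) (al k l) 0 i

lemma mv_h {k : ℕ} {l : La k} {i : Om} {j : ℕ} (hj : j + 2 ≤ k) (hjk : j % 2 = k % 2) :
    (mv k l i j).1 = (i j).1 + al k l j := by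
  simp only [mv, act]; rw [if_pos ⟨hjk, by omega⟩]

lemma mv_y {k : ℕ} {l : La k} {i : Om} :
    (mv k l i k).2.2 = (i k).2.2 + hk k (i (k+1)) (al k l) := by
  simp only [mv, act]; rw [if_pos ⟨trivial, by omega⟩]; simp

lemma mv_ne {k : ℕ} {l : La k} {i : Om} {j : ℕ} (hjk : j % 2 ≠ k % 2) : mv k l i j = i j :=
  act_of_ne hjk

lemma al_inj {k : ℕ} {l l' : La k} (h : ∀ j, j + 2 ≤ k → j % 2 = k % 2 → al k l j = al k l' j) :
    l = l' := by
  funext t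
  have := h (k - 2 - 2*t) (by omega) (by omega)
  simp only [al] at this
  rw [if_pos (by omega), if_pos (by omega), show (k - 2 - (k - 2 - 2*t.1))/2 = t by omega] at this
  simpa [xt] using this

lemma z2fe {n : ℕ} {x y z : Fin n → ZMod 2} (h : x + y = z) : y = z + x := by
  rw [← h, add_comm x y, add_assoc, z2f, add_zero]

/-- visibility of l -/
lemma vis {k M ℓ : ℕ} {l l' : La k} {i b b' : Om} (hℓ : k ≤ ℓ + 1) {e e' : EE M}
    (hb : ∀ j, j + 2 ≤ k → b j = mv k l i j) (hb' : ∀ j, j + 2 ≤ k → b' j = mv k l' i j)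
    (he : e ∈ cyl M ℓ b) (he' : e' ∈ cyl M ℓ b') (h : labE M (k%2) e = labE M (k%2) e') :
    l = l' := by
  rw [mem_cyl] at he he'
  apply al_inj
  intro j hj hjk
  have h1 := congrFun (labE_eq.1 h) j
  simp only [lab, hjk, if_true] at h1
  rw [he j (by omega), he' j (by omega), hb j hj, hb' j hj] at h1
  have h2 := congrArg Prod.fst h1
  rw [mv_h hj hjk, mv_h hj hjk] at h2
  exact add_left_cancel h2

open Classical in
lemma cntA_own (k m : ℕ) (hm : k + 2 ≤ 2*m) (i : Om) (ρ : EE (2*m)) :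
    (Finset.univ.filter fun j : La k × {σ : Sy (k+1) // σ ≠ i (k+1)} =>
      ∃ e ∈ cyl (2*m) (k+2) (Function.update (mv k j.1 i) (k+1) j.2.1), labE (2*m) ((k+1)%2) e = ρ).card
      ≤ 2^(k/2 - dd k) := by
  by_cases hρ : ρ.1 (k+1) = i (k+1)
  · rw [Finset.card_eq_zero.2]
    · positivity
    rw [Finset.filter_eq_empty_iff]
    rintro ⟨l, σ, hσ⟩ - ⟨e, he, h⟩
    rw [mem_cyl] at he
    apply hσ
    have h1 := he (k+1) (by omega)
    have h2 : lab (2*m) ((k+1)%2) e.1 (k+1) = ρ.1 (k+1) := congrFun (congrArg Subtype.val h) (k+1)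
    simp [lab] at h2 h1
    rw [← h1, h2, hρ]
  · refine le_trans ?_ (fib2 k (ρ.1 (k+1)) (i (k+1)) hρ ((ρ.1 k).2.2 + ((i k).2.2 + hk k (ρ.1 (k+1)) (hh i))))
    have hsig : ∀ j : La k × {σ : Sy (k+1) // σ ≠ i (k+1)}, (∃ e ∈ cyl (2*m) (k+2)
      (Function.update (mv k j.1 i) (k+1) j.2.1), labE (2*m) ((k+1)%2) e = ρ) → j.2.1 = ρ.1 (k+1) := by
      rintro ⟨l, σ, hσ⟩ ⟨e, he, h⟩
      rw [mem_cyl] at he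
      have h1 := he (k+1) (by omega)
      have h2 : lab (2*m) ((k+1)%2) e.1 (k+1) = ρ.1 (k+1) := congrFun (congrArg Subtype.val h) (k+1)
      simp [lab] at h2 h1
      rw [← h2, h1]
    apply Finset.card_le_card_of_injOn (fun j => j.1)
    · rintro ⟨l, σ, hσ⟩ hj
      replace hj := (Finset.mem_filter.1 (Finset.mem_coe.1 hj)).2
      refine Finset.mem_coe.2 (Finset.mem_filter.2 ⟨Finset.mem_univ _, ?_⟩)
      have hs := hsig _ hj
      simp only at hs
      obtain ⟨e, he, h⟩ := hj
      rw [mem_cyl] at he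
      have h2 : lab (2*m) ((k+1)%2) e.1 k = ρ.1 k := congrFun (congrArg Subtype.val h) k
      have h3 := congrArg (fun x => x.2.2) h2
      simp only [lab, show ¬ (k % 2 = (k+1)%2) by omega, if_false, ty, show k + 1 < 2*m by omega, if_true] at h3
      have ek : e.1 k = mv k l i k := by rw [he k (by omega)]; simp
      have ek1 : e.1 (k+1) = σ := by rw [he (k+1) (by omega)]; simp
      rw [ek, ek1, mv_y, hs, hk_congr k _ (hh e.1) (hh i + al k l), hk_add] at h3
      · rw [← h3]
        generalize hk k (ρ.1 (k+1)) (al k l) = A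
        generalize hk k (i (k+1)) (al k l) = B
        generalize hk k (ρ.1 (k+1)) (hh i) = C
        rw [show (i k).2.2 + B + (C + A) + ((i k).2.2 + C) = A + B + (((i k).2.2 + (i k).2.2) + (C + C)) by abel,
          z2f, z2f]; simp
      · intro j hj hjk
        simp only [hh, Pi.add_apply]
        rw [he j (by omega), Function.update_of_ne (by omega), mv_h hj hjk]
    · rintro ⟨l, σ, hσ⟩ hj ⟨l', σ', hσ'⟩ hj' h
      replace hj := (Finset.mem_filter.1 (Finset.mem_coe.1 hj)).2
      replace hj' := (Finset.mem_filter.1 (Finset.mem_coe.1 hj')).2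
      have hs := hsig _ hj
      have hs' := hsig _ hj'
      simp only at h hs hs'
      simp [h, hs, hs']

open Classical in
lemma cntA_oth (k m : ℕ) (i : Om) (ρ : EE (2*m)) :
    (Finset.univ.filter fun j : La k × {σ : Sy (k+1) // σ ≠ i (k+1)} =>
      ∃ e ∈ cyl (2*m) (k+2) (Function.update (mv k j.1 i) (k+1) j.2.1), labE (2*m) (k%2) e = ρ).card
      ≤ 4 := by
  have hc : Fintype.card (ZMod 2 × ZMod 2) = 4 := by simp
  rw [← hc, ← Finset.card_univ]
  apply Finset.card_le_card_of_injOn (fun j => (j.2.1.1, j.2.1.2.1)) 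
    (fun _ _ => Finset.mem_coe.2 (Finset.mem_univ _))
  rintro ⟨l, σ, hσ⟩ hj ⟨l', σ', hσ'⟩ hj' h
  simp only [Finset.coe_filter, Finset.mem_univ, true_and, Set.mem_ofPred_eq, Prod.mk.injEq] at hj hj' h
  obtain ⟨e, he, hl⟩ := hj
  obtain ⟨e', he', hl'⟩ := hj'
  have hle := hl.trans hl'.symm
  have hll : l = l' := vis (ℓ := k+2) (by omega) (fun j hj => Function.update_of_ne (by omega) _ _)
    (fun j hj => Function.update_of_ne (by omega) _ _) he he' hle
  subst hll
  rw [mem_cyl] at he he'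
  have es : e.1 (k+1) = σ := by rw [he (k+1) (by omega)]; simp
  have es' : e'.1 (k+1) = σ' := by rw [he' (k+1) (by omega)]; simp
  have := recon (ℓ := k+2) (labE_eq.1 hle) (s := e.1) (s' := e'.1) (by
      intro j hj hjk
      by_cases hj1 : j = k+1
      · subst hj1; rw [es, es', h.1]
      · rw [he j hj, he' j hj, Function.update_of_ne hj1, Function.update_of_ne hj1]) (by
      intro j hj hjk
      by_cases hj1 : j = k+1
      · subst hj1; rw [es, es', h.2]
      · rw [he j hj, he' j hj, Function.update_of_ne hj1, Function.update_of_ne hj1]) (by omega) (k+1) (by omega)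
  rw [es, es'] at this
  subst this
  rfl

open Classical in
lemma cntB_own (k m : ℕ) (hm : k + 1 = 2*m) (i : Om) (ρ : EE (2*m)) :
    (Finset.univ.filter fun j : La k =>
      ∃ e ∈ cyl (2*m) (k+1) (mv k j i), labE (2*m) ((k+1)%2) e = ρ).card
      ≤ 2^(k/2 - dd k) := by
  refine le_trans (Finset.card_le_card ?_) (fib1 k (i (k+1)) ((ρ.1 k).2.2 + (i k).2.2))
  intro l
  simp only [Finset.mem_filter, Finset.mem_univ, true_and]
  rintro ⟨e, he, h⟩
  rw [mem_cyl] at he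
  have h2 : lab (2*m) ((k+1)%2) e.1 k = ρ.1 k := congrFun (congrArg Subtype.val h) k
  have h3 := congrArg (fun x => x.2.2) h2
  simp only [lab, show ¬ (k % 2 = (k+1)%2) by omega, if_false, ty, show ¬ k + 1 < 2*m by omega, add_zero] at h3
  rw [he k (by omega), mv_y] at h3
  exact z2fe h3

open Classical in
lemma cntB_oth (k m : ℕ) (i : Om) (ρ : EE (2*m)) :
    (Finset.univ.filter fun j : La k =>
      ∃ e ∈ cyl (2*m) (k+1) (mv k j i), labE (2*m) (k%2) e = ρ).card ≤ 1 := by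
  rw [Finset.card_le_one]
  intro l hl l' hl'
  simp only [Finset.mem_filter, Finset.mem_univ, true_and] at hl hl'
  obtain ⟨e, he, h⟩ := hl
  obtain ⟨e', he', h'⟩ := hl'
  exact vis (ℓ := k+1) (by omega) (fun _ _ => rfl) (fun _ _ => rfl) he he' (h.trans h'.symm)

end APC

namespace APC

variable {𝕜 : Type*} [RCLike 𝕜]

abbrev HH (𝕜 : Type*) [RCLike 𝕜] (m : ℕ) : Type _ := EuclideanSpace 𝕜 (EE (2*m))
def OP (𝕜 : Type*) [RCLike 𝕜] (m : ℕ) : Type _ := HH 𝕜 m →L[𝕜] HH 𝕜 m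
instance {m : ℕ} : NormedAddCommGroup (OP 𝕜 m) :=
  inferInstanceAs (NormedAddCommGroup (HH 𝕜 m →L[𝕜] HH 𝕜 m))
instance {m : ℕ} : NormedSpace 𝕜 (OP 𝕜 m) :=
  inferInstanceAs (NormedSpace 𝕜 (HH 𝕜 m →L[𝕜] HH 𝕜 m))
abbrev ZZ (𝕜 : Type*) [RCLike 𝕜] : Type _ := lp (fun m : ℕ => OP 𝕜 m) ∞

lemma op_lin (m : ℕ) {J : Type*} [Fintype J] (ε : J → 𝕜) (c : J → EE (2*m) → 𝕜) :
    op m (fun e => ∑ j, ε j * c j e) = ∑ j, ε j • op m (c j) := by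
  ext φ κ
  rw [op_apply]
  simp only [sum_apply, smul_apply, WithLp.ofLp_sum, WithLp.ofLp_smul,
    Finset.sum_apply, Pi.smul_apply, smul_eq_mul, op_apply, Finset.mul_sum]
  rw [Finset.sum_comm]
  refine Finset.sum_congr rfl fun s _ => ?_
  split_ifs
  · rw [Finset.sum_mul]
    refine Finset.sum_congr rfl fun j _ => by ring
  · simp

lemma op_sub (m : ℕ) (c d : EE (2*m) → 𝕜) :
    op m (fun e => c e - d e) = op m c - op m d := by
  ext φ κ
  have : (op m c - op m d) φ = op m c φ - op m d φ := rfl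
  rw [this, PiLp.sub_apply, op_apply, op_apply, op_apply, ← Finset.sum_sub_distrib]
  refine Finset.sum_congr rfl fun s _ => ?_
  split_ifs
  · ring
  · simp

def xb (n : ℕ) (b : Om) (m : ℕ) : HH 𝕜 m →L[𝕜] HH 𝕜 m :=
  if n ≤ 2*m then ((2:𝕜)^m)⁻¹ • op m (ind (2*m) n b) else 0

lemma norm2 (m : ℕ) : ‖((2:𝕜)^m)⁻¹‖ = ((2:ℝ)^m)⁻¹ := by
  rw [norm_inv, norm_pow, RCLike.norm_two]

lemma xb_norm (n : ℕ) (b : Om) (m : ℕ) : ‖(xb n b m : HH 𝕜 m →L[𝕜] HH 𝕜 m)‖ ≤ 1 := by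
  unfold xb
  split_ifs with h
  · have := norm_op_le (𝕜 := 𝕜) m n (J := Unit) (fun _ => b) (fun _ => 1) (by simp) 1 1
      (fun ρ => (Finset.card_le_univ _).trans (by simp)) (fun ρ => (Finset.card_le_univ _).trans (by simp))
    simp only [Finset.univ_unique, Finset.sum_const, Finset.card_singleton, one_smul, one_mul, Nat.cast_one] at this
    have h2 : (4:ℝ)^(m-n/2) ≤ (2^m)^2 := by
      rw [← pow_mul, mul_comm m 2, pow_mul]; norm_num; gcongr <;> [norm_num; omega]
    have h3 := abs_le_of_sq_le_sq' (this.trans h2) (by positivity)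
    rw [norm_smul, norm2]
    have : (0:ℝ) < 2^m := by positivity
    rw [inv_mul_le_iff₀ this, mul_one]
    exact h3.2
  · simp

def X (n : ℕ) (b : Om) : ZZ 𝕜 := ⟨fun m => xb n b m, memℓp_infty ⟨1, by
  rintro _ ⟨m, rfl⟩
  exact xb_norm n b m⟩⟩

def comp (z : ZZ 𝕜) (m : ℕ) : HH 𝕜 m →L[𝕜] HH 𝕜 m := z m

lemma comp_norm (z : ZZ 𝕜) (m : ℕ) : ‖comp z m‖ ≤ ‖z‖ :=
  lp.norm_apply_le_norm (by simp) z m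

def compL (m : ℕ) : ZZ 𝕜 →ₗ[𝕜] (HH 𝕜 m →L[𝕜] HH 𝕜 m) where
  toFun z := comp z m
  map_add' _ _ := rfl
  map_smul' _ _ := rfl

lemma X_apply (n : ℕ) (b : Om) (m : ℕ) : comp (X n b : ZZ 𝕜) m = xb n b m := rfl

lemma xb_congr {n : ℕ} {b b' : Om} (h : ∀ k < n, b k = b' k) (m : ℕ) :
    (xb n b m : HH 𝕜 m →L[𝕜] HH 𝕜 m) = xb n b' m := by
  have : (ind (2*m) n b : EE (2*m) → 𝕜) = ind (2*m) n b' := by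
    funext e
    unfold ind
    congr 1
    apply propext
    refine forall₂_congr fun k hk => ?_
    rw [h k hk]
  unfold xb; rw [this]

lemma X_congr {n : ℕ} {b b' : Om} (h : ∀ k < n, b k = b' k) : (X n b : ZZ 𝕜) = X n b' := by
  apply Subtype.ext
  funext m
  exact xb_congr h m

lemma ind_split (M n : ℕ) (b : Om) (e : EE M) :
    (ind M n b e : 𝕜) - ind M (n+1) b e =
      ∑ σ : {σ : Sy n // σ ≠ b n}, ind M (n+1) (Function.update b n σ.1) e := by
  classical
  have h1 : ∀ σ : Sy n, (ind M (n+1) (Function.update b n σ) e : 𝕜) =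
      if e.1 n = σ then ind M n b e else 0 := by
    intro σ
    unfold ind
    have : (∀ k < n+1, e.1 k = Function.update b n σ k) ↔ e.1 n = σ ∧ ∀ k < n, e.1 k = b k := by
      constructor
      · intro h
        refine ⟨by simpa using h n (by omega), fun k hk => ?_⟩
        rw [h k (by omega), Function.update_of_ne (by omega)]
      · rintro ⟨h, h'⟩ k hk
        by_cases hkn : k = n
        · subst hkn; simpa using h
        · rw [Function.update_of_ne hkn, h' k (by omega)]
    simp only [this]
    by_cases h : e.1 n = σ <;> simp [h]
  simp only [h1]
  have h2 : (ind M (n+1) b e : 𝕜) = if e.1 n = b n then ind M n b e else 0 := by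
    rw [← h1, Function.update_eq_self]
  rw [h2]
  split_ifs with h
  · rw [sub_self]
    symm
    apply Finset.sum_eq_zero
    rintro ⟨σ, hσ⟩ -
    rw [if_neg]
    rw [h]; exact hσ.symm
  · rw [Finset.sum_eq_single ⟨e.1 n, h⟩]
    · simp
    · rintro ⟨σ, hσ⟩ - hne
      rw [if_neg]
      intro h'
      apply hne
      ext1; exact h'.symm
    · simp

def Dl (k : ℕ) (i : Om) (ε : La k → 𝕜) : ZZ 𝕜 :=
  ∑ l, ε l • (X (k+1) (mv k l i) - X (k+2) (mv k l i))

lemma Dl_apply (k : ℕ) (i : Om) (ε : La k → 𝕜) (m : ℕ) :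
    comp (Dl k i ε) m = ∑ l, ε l • (xb (k+1) (mv k l i) m - xb (k+2) (mv k l i) m) := by
  change compL m (Dl k i ε) = _
  unfold Dl
  rw [map_sum]
  refine Finset.sum_congr rfl fun l _ => ?_
  rw [map_smul, map_sub]
  rfl

lemma Dl_block (k : ℕ) (i : Om) (ε : La k → 𝕜) (hε : ∀ l, ‖ε l‖ ≤ 1) (m : ℕ) :
    ‖comp (Dl k i ε) m‖^2 ≤ 2^(k/2 - dd k) / 4^(k/2) := by
  classical
  rw [Dl_apply]
  have aux : ∀ A : HH 𝕜 m →L[𝕜] HH 𝕜 m, ∀ r : ℝ, ‖A‖^2 ≤ 4^m * r → ‖((2:𝕜)^m)⁻¹ • A‖^2 ≤ r := by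
    intro A r h
    rw [norm_smul, norm2, mul_pow, inv_pow, ← pow_mul, mul_comm m 2, pow_mul,
      show (2:ℝ)^2 = 4 by norm_num, inv_mul_le_iff₀ (by positivity)]
    exact h
  by_cases h2 : k + 2 ≤ 2*m
  · have h1 : k + 1 ≤ 2*m := by omega
    have : ∑ l, ε l • (xb (k+1) (mv k l i) m - xb (k+2) (mv k l i) m) = ((2:𝕜)^m)⁻¹ •
        op m (fun e => ∑ j : La k × {σ : Sy (k+1) // σ ≠ i (k+1)}, ε j.1 * ind (2*m) (k+2)
          (Function.update (mv k j.1 i) (k+1) j.2.1) e) := by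
      have e1 : ∀ l, (xb (k+1) (mv k l i) m - xb (k+2) (mv k l i) m : HH 𝕜 m →L[𝕜] HH 𝕜 m) =
          ((2:𝕜)^m)⁻¹ • (op m (ind (2*m) (k+1) (mv k l i)) - op m (ind (2*m) (k+2) (mv k l i))) := by
        intro l
        unfold xb
        rw [if_pos h1, if_pos h2, smul_sub]
      have e2 : ∀ l, (op m (ind (2*m) (k+1) (mv k l i)) - op m (ind (2*m) (k+2) (mv k l i)) : HH 𝕜 m →L[𝕜] HH 𝕜 m) =
          ∑ σ : {σ : Sy (k+1) // σ ≠ i (k+1)}, op m (ind (2*m) (k+2) (Function.update (mv k l i) (k+1) σ.1)) := by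
        intro l
        have hs := op_lin (𝕜 := 𝕜) m (J := {σ : Sy (k+1) // σ ≠ i (k+1)}) (fun _ => 1)
          (fun σ => ind (2*m) (k+2) (Function.update (mv k l i) (k+1) σ.1))
        simp only [one_smul, one_mul] at hs
        rw [← hs]
        have hm : mv k l i (k+1) = i (k+1) := mv_ne (by omega)
        have hsp := fun e => ind_split (𝕜 := 𝕜) (2*m) (k+1) (mv k l i) e
        rw [hm] at hsp
        simp only [← hsp]
        exact (op_sub m _ _).symm
      rw [op_lin, Fintype.sum_prod_type, Finset.smul_sum]
      refine Finset.sum_congr rfl fun l _ => ?_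
      rw [e1, e2, smul_comm, Finset.smul_sum]
    rw [this]
    apply aux
    have hcalc : ((4 * 2^(k/2 - dd k) * 4^(m - (k+2)/2) : ℝ)) ≤ 4^m * (2^(k/2 - dd k) / 4^(k/2)) := by
      have e : m = (m - (k+2)/2) + 1 + k/2 := by omega
      have : (4:ℝ)^m = 4^(m - (k+2)/2) * 4 * 4^(k/2) := by
        conv_lhs => rw [e, pow_add, pow_succ]
      rw [this]
      apply le_of_eq
      field_simp
    rcases Nat.mod_two_eq_zero_or_one k with hk | hk
    · have hk1 : (k+1)%2 = 1 := by omega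
      refine (norm_op_le m (k+2) (fun j : La k × {σ : Sy (k+1) // σ ≠ i (k+1)} => Function.update (mv k j.1 i) (k+1) j.2.1) (fun j => ε j.1) (fun j => hε j.1) 4 (2^(k/2 - dd k)) ?_ ?_).trans ?_
      · intro ρ; simpa only [hk] using cntA_oth k m i ρ
      · intro ρ; simpa only [hk1] using cntA_own k m h2 i ρ
      · push_cast; exact hcalc
    · have hk1 : (k+1)%2 = 0 := by omega
      refine (norm_op_le m (k+2) (fun j : La k × {σ : Sy (k+1) // σ ≠ i (k+1)} => Function.update (mv k j.1 i) (k+1) j.2.1) (fun j => ε j.1) (fun j => hε j.1) (2^(k/2 - dd k)) 4 ?_ ?_).trans ?_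
      · intro ρ; simpa only [hk1] using cntA_own k m h2 i ρ
      · intro ρ; simpa only [hk] using cntA_oth k m i ρ
      · push_cast; rw [mul_comm _ (4:ℝ)]; exact hcalc
  · by_cases h1 : k + 1 ≤ 2*m
    · have hm : k + 1 = 2*m := by omega
      have : ∑ l, ε l • (xb (k+1) (mv k l i) m - xb (k+2) (mv k l i) m) = ((2:𝕜)^m)⁻¹ •
        op m (fun e => ∑ l : La k, ε l * ind (2*m) (k+1) (mv k l i) e) := by
        rw [op_lin, Finset.smul_sum]
        refine Finset.sum_congr rfl fun l _ => ?_
        unfold xb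
        rw [if_pos h1, if_neg h2, sub_zero, smul_comm]
      rw [this]
      apply aux
      have hk : k % 2 = 1 := by omega
      have hk1 : (k+1) % 2 = 0 := by omega
      refine (norm_op_le m (k+1) (fun l => mv k l i) ε hε (2^(k/2 - dd k)) 1 ?_ ?_).trans ?_
      · intro ρ; simpa only [hk1] using cntB_own k m hm i ρ
      · intro ρ; simpa only [hk] using cntB_oth k m i ρ
      · have e : m = (m - (k+1)/2) + k/2 + 1 := by omega
        have : (4:ℝ)^m = 4^(m - (k+1)/2) * 4^(k/2) * 4 := by
          conv_lhs => rw [e, pow_succ, pow_add]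
        rw [this]
        push_cast
        rw [show ((4:ℝ)^(m - (k+1)/2) * 4^(k/2) * 4) * (2^(k/2 - dd k) / 4^(k/2)) =
          4 * (2^(k/2 - dd k) * 4^(m - (k+1)/2)) by field_simp]
        have : (0:ℝ) ≤ 2^(k/2 - dd k) * 4^(m - (k+1)/2) := by positivity
        linarith
    · have : ∀ l, (xb (k+1) (mv k l i) m - xb (k+2) (mv k l i) m : HH 𝕜 m →L[𝕜] HH 𝕜 m) = 0 := by
        intro l; unfold xb; rw [if_neg h1, if_neg h2, sub_zero]
      have hz : ∑ l, ε l • (xb (k+1) (mv k l i) m - xb (k+2) (mv k l i) m) = (0 : HH 𝕜 m →L[𝕜] HH 𝕜 m) :=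
        Finset.sum_eq_zero (fun l _ => by
          rw [this l]
          exact smul_zero (A := HH 𝕜 m →L[𝕜] HH 𝕜 m) (ε l))
      rw [hz]
      have : (0:ℝ) ≤ 2^(k/2 - dd k) / 4^(k/2) := by positivity
      simpa using this

lemma Dl_norm (k : ℕ) (i : Om) (ε : La k → 𝕜) (hε : ∀ l, ‖ε l‖ ≤ 1) :
    ‖Dl k i ε‖^2 ≤ 2^(k/2 - dd k) / 4^(k/2) := by
  have hnn : (0:ℝ) ≤ 2^(k/2 - dd k) / 4^(k/2) := by positivity
  suffices ‖Dl k i ε‖ ≤ √(2^(k/2 - dd k) / 4^(k/2)) by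
    calc _ ≤ (√(2^(k/2 - dd k) / 4^(k/2) : ℝ))^2 := by gcongr
      _ = _ := Real.sq_sqrt hnn
  refine lp.norm_le_of_forall_le (Real.sqrt_nonneg _) fun m => ?_
  exact Real.le_sqrt_of_sq_le (Dl_block k i ε hε m)

end APC

namespace APC

variable {𝕜 : Type*} [RCLike 𝕜]

/-! Rademacher orthogonality -/
def sb (b : Bool) : 𝕜 := if b then 1 else -1

lemma sb_norm (b : Bool) : ‖(sb b : 𝕜)‖ = 1 := by cases b <;> simp [sb]
lemma sb_not (b : Bool) : (sb (!b) : 𝕜) = - sb b := by cases b <;> simp [sb]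
lemma sb_sq (b : Bool) : (sb b : 𝕜) * sb b = 1 := by cases b <;> simp [sb]

lemma rad {Λ : Type*} [Fintype Λ] [DecidableEq Λ] (l l' : Λ) :
    ∑ ε : Λ → Bool, (sb (ε l) : 𝕜) * sb (ε l') = if l = l' then 2^(Fintype.card Λ) else 0 := by
  split_ifs with h
  · subst h
    simp [sb_sq]
  · have hinv : Function.Involutive (fun ε : Λ → Bool => Function.update ε l (! ε l)) := by
      intro ε
      simp
    have := Equiv.sum_comp hinv.toPerm (fun ε : Λ → Bool => (sb (ε l) : 𝕜) * sb (ε l'))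
    simp only [Function.Involutive.coe_toPerm, Function.update_self,
      Function.update_of_ne (Ne.symm h), sb_not, neg_mul, Finset.sum_neg_distrib] at this
    exact self_eq_neg.1 this.symm

def ev (m : ℕ) (ρ κ : EE (2*m)) : ZZ 𝕜 →ₗ[𝕜] 𝕜 where
  toFun z := comp z m (EuclideanSpace.single ρ 1) κ
  map_add' _ _ := rfl
  map_smul' _ _ := rfl

def phi (m : ℕ) (s : EE (2*m)) : ZZ 𝕜 →ₗ[𝕜] 𝕜 :=
  ((th m s.1 : ℤ) : 𝕜) • ev m (labE (2*m) 0 s) (labE (2*m) 1 s)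

lemma th_norm (m : ℕ) (s : Om) : ‖((th m s : ℤ) : 𝕜)‖ = 1 := by
  unfold th sg; split_ifs <;> simp

lemma phi_apply (m : ℕ) (s : EE (2*m)) (z : ZZ 𝕜) : phi m s z =
   ((th m s.1 : ℤ) : 𝕜) * comp z m (EuclideanSpace.single (labE (2*m) 0 s) 1) (labE (2*m) 1 s) := rfl

lemma cs {Γ : Type*} [Fintype Γ] (f g : Γ → 𝕜) (hf : ∀ γ, ‖f γ‖ ≤ 1) (r : ℝ) (hr : 0 ≤ r)
    (hg : ∑ γ, ‖g γ‖^2 ≤ r^2) : ‖∑ γ, f γ * g γ‖ ≤ √(Fintype.card Γ) * r := by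
  calc ‖∑ γ, f γ * g γ‖ ≤ ∑ γ, ‖f γ‖ * ‖g γ‖ := by
        refine (norm_sum_le _ _).trans (le_of_eq ?_); simp
    _ ≤ ∑ γ, 1 * ‖g γ‖ := by gcongr with γ; exact hf γ
    _ ≤ √(∑ γ : Γ, (1:ℝ)^2) * √(∑ γ, ‖g γ‖^2) := Real.sum_mul_le_sqrt_mul_sqrt _ _ _
    _ ≤ √(Fintype.card Γ) * r := by
        gcongr
        · simp
        · exact Real.sqrt_le_iff.2 ⟨hr, hg⟩

lemma fb {Γ : Type*} [Fintype Γ] (m : ℕ) (s : Γ → EE (2*m)) (hs : Function.Injective s)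
    (p : ℕ) (hp : p = 0 ∨ p = 1) (ρ : EE (2*m)) (hl : ∀ γ, labE (2*m) p (s γ) = ρ)
    (a : Γ → 𝕜) (ha : ∀ γ, ‖a γ‖ ≤ 1) (z : ZZ 𝕜) :
    ‖∑ γ, a γ * phi m (s γ) z‖ ≤ √(Fintype.card Γ) * ‖z‖ := by
  have hath : ∀ γ, ‖a γ * ((th m (s γ).1 : ℤ) : 𝕜)‖ ≤ 1 := by
    intro γ; rw [norm_mul, th_norm, mul_one]; exact ha γ
  have hsum : ∑ γ, a γ * phi m (s γ) z = ∑ γ, (a γ * ((th m (s γ).1 : ℤ) : 𝕜)) *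
      comp z m (EuclideanSpace.single (labE (2*m) 0 (s γ)) 1) (labE (2*m) 1 (s γ)) := by
    refine Finset.sum_congr rfl fun γ _ => ?_
    rw [phi_apply, mul_assoc]
  rw [hsum]
  rcases hp with rfl | rfl
  · simp only [hl]
    refine cs _ _ hath _ (norm_nonneg _) ?_
    have hinj : Function.Injective fun γ => labE (2*m) 1 (s γ) := by
      intro γ γ' h
      apply hs
      ext1
      exact lab_inj (labE_eq.1 ((hl γ).trans (hl γ').symm)) (labE_eq.1 h)
    set w : HH 𝕜 m := comp z m (EuclideanSpace.single ρ 1) with hw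
    have hwn : ‖w‖ ≤ ‖z‖ := by
      refine ((comp z m).le_opNorm _).trans ?_
      rw [PiLp.norm_single]
      simpa using comp_norm z m
    calc ∑ γ, ‖w (labE (2*m) 1 (s γ))‖^2 = ∑ x ∈ Finset.univ.map ⟨_, hinj⟩, ‖w x‖^2 := by
          rw [Finset.sum_map]; rfl
      _ ≤ ∑ x, ‖w x‖^2 := by
          apply Finset.sum_le_univ_sum_of_nonneg; intro; positivity
      _ = ‖w‖^2 := (EuclideanSpace.norm_sq_eq w).symm
      _ ≤ ‖z‖^2 := by gcongr
  · simp only [hl]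
    have hinj : Function.Injective fun γ => labE (2*m) 0 (s γ) := by
      intro γ γ' h
      apply hs
      ext1
      exact lab_inj (labE_eq.1 h) (labE_eq.1 ((hl γ).trans (hl γ').symm))
    set v : HH 𝕜 m := ∑ γ, (a γ * ((th m (s γ).1 : ℤ) : 𝕜)) •
      (EuclideanSpace.single (labE (2*m) 0 (s γ)) 1 : HH 𝕜 m) with hv
    have e : ∑ γ, (a γ * ((th m (s γ).1 : ℤ) : 𝕜)) *
      comp z m (EuclideanSpace.single (labE (2*m) 0 (s γ)) 1) ρ = comp z m v ρ := by
      rw [hv, map_sum, WithLp.ofLp_sum, Finset.sum_apply]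
      refine Finset.sum_congr rfl fun γ _ => ?_
      rw [map_smul]; rfl
    rw [e]
    have hvn : ‖v‖^2 ≤ Fintype.card Γ := by
      have horth : ‖v‖^2 = ∑ γ, ‖a γ * ((th m (s γ).1 : ℤ) : 𝕜)‖^2 := by
        have ho : Orthonormal 𝕜 (fun γ => (EuclideanSpace.single (labE (2*m) 0 (s γ)) 1 : HH 𝕜 m)) := by
          exact EuclideanSpace.orthonormal_single.comp _ hinj
        have h := ho.inner_sum (fun γ => a γ * ((th m (s γ).1 : ℤ) : 𝕜)) (fun γ => a γ * ((th m (s γ).1 : ℤ) : 𝕜)) Finset.univ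
        rw [← hv, inner_self_eq_norm_sq_to_K] at h
        simp only [RCLike.conj_mul] at h
        exact_mod_cast h
      rw [horth]
      calc _ ≤ ∑ γ : Γ, (1:ℝ) := by
            gcongr with γ; exact pow_le_one₀ (norm_nonneg _) (hath γ)
        _ = _ := by simp
    calc ‖comp z m v ρ‖ ≤ ‖comp z m v‖ := PiLp.norm_apply_le _ _
      _ ≤ ‖comp z m‖ * ‖v‖ := (comp z m).le_opNorm v
      _ ≤ ‖z‖ * √(Fintype.card Γ) := by
          gcongr
          · exact comp_norm z m
          · exact Real.le_sqrt_of_sq_le hvn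
      _ = _ := mul_comm _ _

lemma avg {Γ Λ : Type*} [Fintype Γ] [Fintype Λ] [DecidableEq Λ] [Nonempty Γ] (m : ℕ)
    (g : Γ → EE (2*m) → EE (2*m)) (hg : ∀ γ, Function.Bijective (g γ))
    (hinj : ∀ s, Function.Injective fun γ => g γ s) (p : ℕ) (hp : p = 0 ∨ p = 1)
    (hlab : ∀ γ s, labE (2*m) p (g γ s) = labE (2*m) p s) (la : Γ → Λ)
    (y : EE (2*m) → ZZ 𝕜) (Y : EE (2*m) → Λ → ZZ 𝕜) (hy : ∀ γ s, y (g γ s) = Y s (la γ))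
    (T : ZZ 𝕜 →L[𝕜] ZZ 𝕜) (C : ℝ)
    (hC : ∀ s, ∀ ε : Λ → Bool, ‖T (∑ l, (sb (ε l) : 𝕜) • Y s l)‖ ≤ C) :
    ‖∑ s, phi m s (T (y s))‖ ≤ Fintype.card (EE (2*m)) / √(Fintype.card Γ) * C := by
  have hΓ : (0:ℝ) < Fintype.card Γ := by exact_mod_cast Fintype.card_pos
  have h1 : ∀ s, ‖∑ γ, phi m (g γ s) (T (Y s (la γ)))‖ ≤ √(Fintype.card Γ) * C := by
    intro s
    have hexp : ∀ ε : Λ → Bool, ∑ γ, (sb (ε (la γ)) : 𝕜) * phi m (g γ s) (T (∑ l, (sb (ε l) : 𝕜) • Y s l))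
        = ∑ γ, ∑ l, ((sb (ε (la γ)) : 𝕜) * sb (ε l)) * phi m (g γ s) (T (Y s l)) := by
      intro ε
      refine Finset.sum_congr rfl fun γ _ => ?_
      rw [map_sum, map_sum, Finset.mul_sum]
      refine Finset.sum_congr rfl fun l _ => ?_
      rw [map_smul, map_smul, smul_eq_mul, mul_assoc]
    have h2 : ∑ ε : Λ → Bool, ∑ γ, (sb (ε (la γ)) : 𝕜) * phi m (g γ s) (T (∑ l, (sb (ε l) : 𝕜) • Y s l))
        = 2^(Fintype.card Λ) * ∑ γ, phi m (g γ s) (T (Y s (la γ))) := by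
      simp only [hexp]
      rw [Finset.sum_comm, Finset.mul_sum]
      refine Finset.sum_congr rfl fun γ _ => ?_
      rw [Finset.sum_comm]
      simp only [← Finset.sum_mul, rad, ite_mul, zero_mul]
      simp
    have h3 : ‖(2:𝕜)^(Fintype.card Λ) * ∑ γ, phi m (g γ s) (T (Y s (la γ)))‖ ≤
        2^(Fintype.card Λ) * (√(Fintype.card Γ) * C) := by
      rw [← h2]
      refine (norm_sum_le _ _).trans ?_
      calc _ ≤ ∑ ε : Λ → Bool, (√(Fintype.card Γ) * C) := by
            refine Finset.sum_le_sum fun ε _ => ?_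
            refine (fb m (fun γ => g γ s) (hinj s) p hp _ (fun γ => hlab γ s) _ (fun γ => (sb_norm _).le) _).trans ?_
            gcongr
            exact hC s ε
        _ = _ := by simp
    rw [norm_mul, norm_pow, RCLike.norm_two] at h3
    exact le_of_mul_le_mul_left h3 (by positivity)
  have h4 : (Fintype.card Γ : 𝕜) * ∑ s, phi m s (T (y s)) =
      ∑ s, ∑ γ, phi m (g γ s) (T (Y s (la γ))) := by
    rw [Finset.sum_comm]
    have : ∀ γ, ∑ s, phi m (g γ s) (T (Y s (la γ))) = ∑ s, phi m s (T (y s)) := by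
      intro γ
      simp only [← hy]
      exact (hg γ).sum_comp (fun s => phi m s (T (y s)))
    simp [this]
  have h5 : Fintype.card Γ * ‖∑ s, phi m s (T (y s))‖ ≤
      Fintype.card (EE (2*m)) * (√(Fintype.card Γ) * C) := by
    have : ‖(Fintype.card Γ : 𝕜) * ∑ s, phi m s (T (y s))‖ = Fintype.card Γ * ‖∑ s, phi m s (T (y s))‖ := by
      rw [norm_mul, RCLike.norm_natCast]
    rw [← this, h4]
    refine (norm_sum_le _ _).trans ((Finset.sum_le_sum fun s _ => h1 s).trans ?_)
    simp
  have hs : √(Fintype.card Γ : ℝ) * √(Fintype.card Γ) = Fintype.card Γ := Real.mul_self_sqrt hΓ.le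
  have hs0 : 0 < √(Fintype.card Γ : ℝ) := Real.sqrt_pos.2 hΓ
  rw [div_mul_eq_mul_div, le_div_iff₀ hs0]
  refine le_of_mul_le_mul_left (a := √(Fintype.card Γ : ℝ)) ?_ hs0
  calc _ = Fintype.card Γ * ‖∑ s, phi m s (T (y s))‖ := by rw [← mul_assoc, mul_comm _ (√(Fintype.card Γ : ℝ)), ← mul_assoc, hs]
    _ ≤ _ := h5
    _ = _ := by ring

end APC

namespace APC

variable {𝕜 : Type*} [RCLike 𝕜]

def bet (m n : ℕ) (T : ZZ 𝕜 →L[𝕜] ZZ 𝕜) : 𝕜 :=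
  (2^m / (Fintype.card (EE (2*m)) : 𝕜)) * ∑ s : EE (2*m), phi m s (T (X n s.1))

instance (M : ℕ) : Nonempty (EE M) := ⟨⟨0, fun _ _ => rfl⟩⟩

lemma bet_sub (m n : ℕ) (T S : ZZ 𝕜 →L[𝕜] ZZ 𝕜) : bet m n (T - S) = bet m n T - bet m n S := by
  unfold bet
  rw [← mul_sub, ← Finset.sum_sub_distrib]
  congr 1
  refine Finset.sum_congr rfl fun s _ => ?_
  rw [← map_sub]; rfl

lemma phi_X (m n : ℕ) (hn : n ≤ 2*m) (s : EE (2*m)) : phi m s (X n s.1 : ZZ 𝕜) = (2^m)⁻¹ := by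
  rw [phi_apply, X_apply]
  unfold xb
  rw [if_pos hn]
  have : (((2:𝕜)^m)⁻¹ • op m (ind (2*m) n s.1)) (EuclideanSpace.single (labE (2*m) 0 s) 1) (labE (2*m) 1 s)
    = ((2:𝕜)^m)⁻¹ * op m (ind (2*m) n s.1) (EuclideanSpace.single (labE (2*m) 0 s) 1) (labE (2*m) 1 s) := rfl
  rw [this, op_apply, Finset.sum_eq_single s]
  · have h1 : (ind (2*m) n s.1 s : 𝕜) = 1 := by simp [ind]
    rw [if_pos rfl, h1]
    have h2 : (((th m s.1 : ℤ) : 𝕜)) * ((th m s.1 : ℤ) : 𝕜) = 1 := by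
      rw [← Int.cast_mul, th_sq]; simp
    simp only [PiLp.single_apply, if_true, mul_one, one_mul]
    rw [mul_left_comm, h2, mul_one]
  · intro s' _ hne
    split_ifs with h
    · have : labE (2*m) 0 s' ≠ labE (2*m) 0 s := by
        intro h'
        apply hne
        ext1
        exact lab_inj (labE_eq.1 h') (labE_eq.1 h)
      simp [this]
    · rfl
  · simp

lemma bet_id (m n : ℕ) (hn : n ≤ 2*m) : bet m n (ContinuousLinearMap.id 𝕜 (ZZ 𝕜)) = 1 := by
  unfold bet
  simp only [ContinuousLinearMap.id_apply, phi_X m n hn]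
  have : (Fintype.card (EE (2*m)) : 𝕜) ≠ 0 := by exact_mod_cast Fintype.card_ne_zero
  simp only [Finset.sum_const, Finset.card_univ, nsmul_eq_mul]
  field_simp

lemma actE_bij (M q : ℕ) (a b : ℕ → ZMod 2) : Function.Bijective (actE M q a b) := by
  have : Function.Involutive (actE M q a b) := fun s => Subtype.ext (act_act _ _ _ _ _)
  exact this.bijective

lemma act_inj {M q : ℕ} {a b a' b' : ℕ → ZMod 2} {s : Om} (h : act M q a b s = act M q a' b' s)
    {j : ℕ} (hj : j < M) (hjq : j % 2 = q) : a j = a' j ∧ b j = b' j := by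
  have := congrFun h j
  simp only [act, hj, hjq, and_self, if_true, Prod.mk.injEq] at this
  exact ⟨add_left_cancel this.1, add_left_cancel this.2.1⟩

abbrev Ta (N : ℕ) : Type := Fin N → ZMod 2 × ZMod 2
def xt2 {B : ℕ} (l : Ta B) (j : ℕ) : ZMod 2 × ZMod 2 := if h : j < B then l ⟨j, h⟩ else 0

/-- start -/
lemma bet_start (m : ℕ) (T : ZZ 𝕜 →L[𝕜] ZZ 𝕜) (C : ℝ) (hC : ∀ i : Om, ‖T (X 1 i)‖ ≤ C) :
    ‖bet m 1 T‖ ≤ C := by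
  have key := avg (𝕜 := 𝕜) (Γ := Ta m) (Λ := Unit) m
    (fun τ => actE (2*m) 1 (fun j => (xt2 τ (j/2)).1) (fun j => (xt2 τ (j/2)).2))
    (fun τ => actE_bij _ _ _ _) (by
      intro s τ τ' h
      funext r
      have h' := act_inj (congrArg Subtype.val h) (j := 2*r+1) (by omega) (by omega)
      have hr : (2*r.1+1)/2 = r := by omega
      simp only [hr, xt2, r.2, dif_pos] at h'
      exact Prod.ext h'.1 h'.2) 0 (Or.inl rfl) (fun τ s => labE_eq.2 (lab_act (by norm_num) (by norm_num) (by norm_num) _ _ _))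
    (fun _ => ()) (fun s => X 1 s.1) (fun s _ => X 1 s.1) (fun τ s => X_congr (by
      intro k hk
      have hne : k % 2 ≠ 1 := by omega
      simp only [actE]
      exact act_of_ne hne)) T C (by
      intro s ε
      simp only [Finset.univ_unique, Finset.sum_singleton, map_smul, norm_smul, sb_norm, one_mul]
      exact hC _)
  have hc : √(Fintype.card (Ta m) : ℝ) = 2^m := by
    have : (Fintype.card (Ta m) : ℝ) = (2^m)^2 := by
      simp only [Fintype.card_fun, Fintype.card_prod, ZMod.card, Fintype.card_fin]
      push_cast; rw [← pow_mul, mul_comm m 2, pow_mul]; norm_num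
    rw [this, Real.sqrt_sq (by positivity)]
  rw [hc] at key
  unfold bet
  rw [norm_mul, norm_div, norm_pow, RCLike.norm_two, RCLike.norm_natCast]
  have h0 : (0:ℝ) < Fintype.card (EE (2*m)) := by exact_mod_cast Fintype.card_pos
  calc _ ≤ 2^m / Fintype.card (EE (2*m)) * (Fintype.card (EE (2*m)) / 2^m * C) := by gcongr
    _ = C := by field_simp

def ga (k : ℕ) {N : ℕ} (γ : La k × Ta N) (j : ℕ) : ZMod 2 :=
  if j ≤ k + 1 then al k γ.1 j else (xt2 γ.2 ((j - k - 2)/2)).1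
def gb (k : ℕ) {N : ℕ} (γ : La k × Ta N) (j : ℕ) : ZMod 2 :=
  if j ≤ k + 1 then 0 else (xt2 γ.2 ((j - k - 2)/2)).2

lemma act_mv (k m : ℕ) (hm : k + 2 ≤ 2*m) {N : ℕ} (γ : La k × Ta N) (s : Om) :
    ∀ j < k + 2, act (2*m) (k%2) (ga k γ) (gb k γ) s j = mv k γ.1 s j := by
  intro j hj
  unfold mv act
  by_cases h : j % 2 = k % 2
  · have c1 : j % 2 = k % 2 ∧ j < 2*m := ⟨h, by omega⟩
    have c2 : j % 2 = k % 2 ∧ j < k+2 := ⟨h, hj⟩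
    have c3 : j + 1 < 2*m := by omega
    have c4 : j + 1 < k+2 := by omega
    have g1 : ga k γ j = al k γ.1 j := by unfold ga; rw [if_pos (by omega)]
    have g2 : gb k γ j = 0 := by unfold gb; rw [if_pos (by omega)]
    have g3 : hk j (s (j+1)) (ga k γ) = hk j (s (j+1)) (al k γ.1) := by
      apply hk_congr
      intro i hi _
      unfold ga
      rw [if_pos (by omega)]
    simp only [c1, c2, c3, c4, and_self, if_true, g1, g2, g3, Pi.zero_apply]
  · rw [if_neg (by tauto), if_neg (by tauto)]

lemma bet_step (m k : ℕ) (hm : k + 2 ≤ 2*m) (T : ZZ 𝕜 →L[𝕜] ZZ 𝕜) (C : ℝ)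
    (hC : ∀ i : Om, ∀ ε : La k → Bool, ‖T (Dl k i (fun l => sb (ε l)))‖ ≤ C) :
    ‖bet m (k+1) T - bet m (k+2) T‖ ≤ 2 * √(2^(k/2)) * C := by
  have key := avg (𝕜 := 𝕜) (Γ := La k × Ta (m - k/2 - 1)) (Λ := La k) m
    (fun γ => actE (2*m) (k%2) (ga k γ) (gb k γ))
    (fun τ => actE_bij _ _ _ _) (by
      intro s γ γ' h
      have h' := fun j => act_inj (congrArg Subtype.val h) (j := j)
      apply Prod.ext
      · apply al_inj
        intro j hj hjk
        have := (h' j (by omega) hjk).1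
        unfold ga at this
        rwa [if_pos (by omega), if_pos (by omega)] at this
      · funext r
        have := h' (k+2+2*r) (by omega) (by omega)
        unfold ga gb at this
        rw [if_neg (by omega), if_neg (by omega), if_neg (by omega), if_neg (by omega)] at this
        have hr : (k+2+2*r.1-k-2)/2 = r := by omega
        simp only [hr, xt2, r.2, dif_pos] at this
        exact Prod.ext this.1 this.2) ((k+1)%2) (by omega)
      (fun τ s => labE_eq.2 (lab_act (by omega) (by omega) (by omega) _ _ _))
    (fun γ => γ.1) (fun s => X (k+1) s.1 - X (k+2) s.1)
    (fun s l => X (k+1) (mv k l s.1) - X (k+2) (mv k l s.1)) (fun γ s => by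
      have h := act_mv k m hm γ s.1
      have e1 : (X (k+1) (actE (2*m) (k%2) (ga k γ) (gb k γ) s).1 : ZZ 𝕜) = X (k+1) (mv k γ.1 s.1) :=
        X_congr (fun j hj => h j (by omega))
      have e2 : (X (k+2) (actE (2*m) (k%2) (ga k γ) (gb k γ) s).1 : ZZ 𝕜) = X (k+2) (mv k γ.1 s.1) :=
        X_congr h
      rw [e1, e2]) T C (fun s ε => hC s.1 ε)
  have hc : (2:ℝ)^m / √(Fintype.card (La k × Ta (m - k/2 - 1)) : ℝ) = 2 * √(2^(k/2)) := by
    have e : (Fintype.card (La k × Ta (m - k/2 - 1)) : ℝ) = 2^(k/2) * (2^(m-k/2-1))^2 := by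
      simp only [Fintype.card_fun, Fintype.card_prod, ZMod.card, Fintype.card_fin]
      push_cast; rw [← pow_mul _ _ 2, mul_comm _ 2, pow_mul]; norm_num
    rw [e, Real.sqrt_mul (by positivity), Real.sqrt_sq (by positivity), div_eq_iff (by positivity)]
    have e2 : m = (k/2) + (m - k/2 - 1) + 1 := by omega
    have e3 : √((2:ℝ)^(k/2)) * √((2:ℝ)^(k/2)) = 2^(k/2) := Real.mul_self_sqrt (by positivity)
    calc (2:ℝ)^m = 2^(k/2) * 2^(m - k/2 - 1) * 2 := by
          conv_lhs => rw [e2, pow_succ, pow_add]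
      _ = √((2:ℝ)^(k/2)) * √((2:ℝ)^(k/2)) * 2^(m - k/2 - 1) * 2 := by rw [e3]
      _ = _ := by ring
  have h0 : (0:ℝ) < Fintype.card (EE (2*m)) := by exact_mod_cast Fintype.card_pos
  have e : bet m (k+1) T - bet m (k+2) T = (2^m / (Fintype.card (EE (2*m)) : 𝕜)) *
      ∑ s : EE (2*m), phi m s (T (X (k+1) s.1 - X (k+2) s.1)) := by
    unfold bet
    rw [← mul_sub, ← Finset.sum_sub_distrib]
    simp only [map_sub]
  rw [e, norm_mul, norm_div, norm_pow, RCLike.norm_two, RCLike.norm_natCast]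
  calc _ ≤ 2^m / Fintype.card (EE (2*m)) * (Fintype.card (EE (2*m)) / √(Fintype.card (La k × Ta (m - k/2 - 1)) : ℝ) * C) := by gcongr
    _ = 2^m / √(Fintype.card (La k × Ta (m - k/2 - 1)) : ℝ) * C := by field_simp
    _ = _ := by rw [hc]

/-- truncation -/
def tr (N : ℕ) (i : Om) : EE N := ⟨fun k => if k < N then i k else 0, fun k hk => by simp [not_lt.2 hk]⟩

lemma tr_eq {N : ℕ} (i : Om) {j : ℕ} (hj : j < N) : (tr N i).1 j = i j := by simp [tr, hj]

lemma mv_congr {k : ℕ} {l : La k} {i i' : Om} (h : ∀ j < k + 2, i j = i' j) :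
    ∀ j < k + 2, mv k l i j = mv k l i' j := by
  intro j hj
  unfold mv act
  by_cases h1 : j % 2 = k % 2
  · have c4 : j + 1 < k+2 := by omega
    rw [h j hj, h (j+1) c4]
  · rw [if_neg (by tauto), if_neg (by tauto), h j hj]

lemma Dl_tr (k : ℕ) (i : Om) (ε : La k → 𝕜) : Dl k i ε = Dl k (tr (k+2) i).1 ε := by
  unfold Dl
  refine Finset.sum_congr rfl fun l _ => ?_
  have h := mv_congr (k := k) (l := l) (i := i) (i' := (tr (k+2) i).1) (fun j hj => (tr_eq i hj).symm)
  rw [X_congr h, X_congr (n := k+1) (fun j hj => h j (by omega))]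

end APC

namespace APC

variable {𝕜 : Type*} [RCLike 𝕜]

lemma card_Ta (m : ℕ) : Fintype.card (Ta m) = 4^m := by
  simp only [Fintype.card_fun, Fintype.card_prod, ZMod.card, Fintype.card_fin]

open Classical in
lemma cnt_end (m m' p : ℕ) (hp : p < 2) (ρ : EE (2*m')) :
    (Finset.univ.filter fun s : EE (2*m) => ∃ e ∈ cyl (2*m') (2*m) s.1, labE (2*m') p e = ρ).card ≤ 4^m := by
  rw [← card_Ta, ← Finset.card_univ]
  apply Finset.card_le_card_of_injOn (fun (s : EE (2*m)) (r : Fin m) =>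
    (((s.1 (2*r+1-p)).1, (s.1 (2*r+1-p)).2.1) : ZMod 2 × ZMod 2)) (fun _ _ => Finset.mem_coe.2 (Finset.mem_univ _))
  intro s hs s' hs' h
  simp only [Finset.coe_filter, Finset.mem_univ, true_and, Set.mem_ofPred_eq, mem_cyl] at hs hs'
  obtain ⟨e, he, hl⟩ := hs
  obtain ⟨e', he', hl'⟩ := hs'
  have hc : ∀ k < 2*m, k % 2 ≠ p → (s.1 k).1 = (s'.1 k).1 ∧ (s.1 k).2.1 = (s'.1 k).2.1 := by
    intro k hk hkp
    have := congrFun h ⟨k/2, by omega⟩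
    have hkk : 2*(k/2)+1-p = k := by omega
    simp only [Prod.mk.injEq] at this
    have hst : ∀ j, j = k → (s.1 j).1 = (s'.1 j).1 ∧ (s.1 j).2.1 = (s'.1 j).2.1 →
      (s.1 k).1 = (s'.1 k).1 ∧ (s.1 k).2.1 = (s'.1 k).2.1 := by
      rintro j rfl h; exact h
    exact hst _ hkk this
  have := recon (labE_eq.1 (hl.trans hl'.symm)) (ℓ := 2*m)
    (fun k hk hkp => by rw [he k hk, he' k hk]; exact (hc k hk hkp).1)
    (fun k hk hkp => by rw [he k hk, he' k hk]; exact (hc k hk hkp).2) hp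
  ext1
  funext k
  by_cases hk : k < 2*m
  · rw [← he k hk, ← he' k hk, this k hk]
  · rw [s.2 k (by omega), s'.2 k (by omega)]

lemma sumX (m : ℕ) (c : EE (2*m) → 𝕜) (hc : ∀ s, ‖c s‖ ≤ 1) :
    ‖∑ s, c s • (X (2*m) s.1 : ZZ 𝕜)‖ ≤ 2^m := by
  classical
  refine lp.norm_le_of_forall_le (by positivity) fun m' => ?_
  change ‖compL m' (∑ s, c s • (X (2*m) s.1 : ZZ 𝕜))‖ ≤ _
  rw [map_sum]
  have e0 : ∑ s, compL m' (c s • (X (2*m) s.1 : ZZ 𝕜)) = ∑ s, c s • (xb (2*m) s.1 m' : HH 𝕜 m' →L[𝕜] HH 𝕜 m') := by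
    refine Finset.sum_congr rfl fun s _ => ?_
    rw [map_smul]; rfl
  rw [e0]
  by_cases h : 2*m ≤ 2*m'
  · have e1 : ∑ s, c s • (xb (2*m) s.1 m' : HH 𝕜 m' →L[𝕜] HH 𝕜 m') =
      ((2:𝕜)^m')⁻¹ • op m' (fun e => ∑ s, c s * ind (2*m') (2*m) s.1 e) := by
      rw [op_lin, Finset.smul_sum]
      refine Finset.sum_congr rfl fun l _ => ?_
      unfold xb
      rw [if_pos h, smul_comm]
    rw [e1, norm_smul, norm2, inv_mul_le_iff₀ (by positivity)]
    have := norm_op_le m' (2*m) (fun s : EE (2*m) => s.1) c hc (4^m) (4^m)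
      (fun ρ => by convert cnt_end m m' 0 (by norm_num) ρ) (fun ρ => by convert cnt_end m m' 1 (by norm_num) ρ)
    refine (abs_le_of_sq_le_sq' (this.trans (le_of_eq ?_)) (by positivity)).2
    push_cast
    have e2 : 2*m/2 = m := by omega
    rw [e2, mul_assoc, ← pow_add, show m + (m' - m) = m' by omega, mul_pow, ← pow_mul, ← pow_mul,
      mul_comm m' 2, mul_comm m 2, pow_mul, pow_mul]
    norm_num
    ring
  · have : ∀ s, c s • (xb (2*m) s.1 m' : HH 𝕜 m' →L[𝕜] HH 𝕜 m') = 0 := by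
      intro s; unfold xb; rw [if_neg h]
      exact smul_zero (A := HH 𝕜 m' →L[𝕜] HH 𝕜 m') (c s)
    rw [Finset.sum_congr rfl fun s _ => this s, Finset.sum_const_zero, norm_zero]
    positivity

lemma phi_norm (m : ℕ) (s : EE (2*m)) (z : ZZ 𝕜) : ‖phi m s z‖ ≤ ‖z‖ := by
  have := fb (Γ := Unit) m (fun _ => s) (fun _ _ _ => rfl) 0 (Or.inl rfl) _ (fun _ => rfl)
    (fun _ => 1) (by simp) z
  simpa using this

lemma card_EE (m : ℕ) : (4:ℝ)^m * 4^m ≤ Fintype.card (EE (2*m)) := by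
  have : Fintype.card (Ta (2*m)) ≤ Fintype.card (EE (2*m)) := by
    apply Fintype.card_le_of_injective (fun (t : Ta (2*m)) =>
      (⟨fun k => ((xt2 t k).1, (xt2 t k).2, 0), fun k hk => by simp [xt2, not_lt.2 hk]⟩ : EE (2*m)))
    intro t t' h
    funext r
    have := congrFun (congrArg Subtype.val h) r
    simp only [xt2, r.2, dif_pos, Prod.mk.injEq] at this
    exact Prod.ext this.1 this.2.1
  rw [card_Ta] at this
  have h2 : ((4^(2*m) : ℕ) : ℝ) ≤ Fintype.card (EE (2*m)) := by exact_mod_cast this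
  rw [← pow_add, ← two_mul]
  simpa using h2

/-- rank one -/
lemma bet_rank1 (m : ℕ) (f : ZZ 𝕜 →L[𝕜] 𝕜) (z : ZZ 𝕜) :
    ‖bet m (2*m) (f.smulRight z)‖ ≤ (‖f‖ * ‖z‖) * (1/4)^m := by
  have h0 : (0:ℝ) < Fintype.card (EE (2*m)) := by exact_mod_cast Fintype.card_pos
  have e : ∑ s : EE (2*m), phi m s ((f.smulRight z) (X (2*m) s.1)) =
      f (∑ s : EE (2*m), phi m s z • X (2*m) s.1) := by
    rw [map_sum]
    refine Finset.sum_congr rfl fun s _ => ?_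
    rw [ContinuousLinearMap.smulRight_apply, map_smul, map_smul, smul_eq_mul, smul_eq_mul, mul_comm]
  have hS : ‖∑ s : EE (2*m), phi m s z • (X (2*m) s.1 : ZZ 𝕜)‖ ≤ ‖z‖ * 2^m := by
    by_cases hz : ‖z‖ = 0
    · have : ∀ s : EE (2*m), phi m s z = 0 := fun s => by
        have := phi_norm m s z; rw [hz] at this; exact norm_le_zero_iff.1 this
      simp [this, hz]
    · have hz' : (0:ℝ) < ‖z‖ := lt_of_le_of_ne (norm_nonneg _) (Ne.symm hz)
      have := sumX m (fun s : EE (2*m) => ((‖z‖:ℝ):𝕜)⁻¹ * phi m s z) (fun s => by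
        rw [norm_mul, norm_inv, RCLike.norm_ofReal, abs_norm, inv_mul_le_iff₀ hz', mul_one]
        exact phi_norm m s z)
      simp only [mul_smul] at this
      rw [← Finset.smul_sum, norm_smul, norm_inv, RCLike.norm_ofReal, abs_norm,
        inv_mul_le_iff₀ hz'] at this
      exact this
  unfold bet
  rw [e, norm_mul, norm_div, norm_pow, RCLike.norm_two, RCLike.norm_natCast]
  calc _ ≤ 2^m / Fintype.card (EE (2*m)) * (‖f‖ * (‖z‖ * 2^m)) := by
        gcongr; exact (f.le_opNorm _).trans (by gcongr)
    _ ≤ 2^m / (4^m*4^m) * (‖f‖ * (‖z‖ * 2^m)) := by gcongr; exact card_EE m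
    _ = _ := by
        have : (4:ℝ)^m = 2^m * 2^m := by rw [← mul_pow]; norm_num
        rw [div_pow, this]; field_simp; ring

lemma fin_rank {E : Type*} [NormedAddCommGroup E] [NormedSpace 𝕜 E] (T : E →L[𝕜] E)
    (hT : FiniteDimensional 𝕜 (LinearMap.range (T : E →ₗ[𝕜] E))) :
    ∃ (N : ℕ) (f : Fin N → E →L[𝕜] 𝕜) (z : Fin N → E), T = ∑ i, (f i).smulRight (z i) := by
  let b := Module.finBasis 𝕜 (LinearMap.range (T : E →ₗ[𝕜] E))
  let T' : E →L[𝕜] LinearMap.range (T : E →ₗ[𝕜] E) := T.codRestrict _ (fun x => ⟨x, rfl⟩)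
  refine ⟨_, fun i => (LinearMap.toContinuousLinearMap (b.coord i)).comp T', fun i => (b i : E), ?_⟩
  ext x
  rw [sum_apply]
  simp only [ContinuousLinearMap.smulRight_apply, ContinuousLinearMap.comp_apply,
    LinearMap.coe_toContinuousLinearMap', Module.Basis.coord_apply]
  have := congrArg Subtype.val (b.sum_repr (T' x))
  rw [Submodule.coe_sum] at this
  exact this.symm

lemma bet_end (T : ZZ 𝕜 →L[𝕜] ZZ 𝕜) (hT : FiniteDimensional 𝕜 (LinearMap.range (T : ZZ 𝕜 →ₗ[𝕜] ZZ 𝕜))) :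
    Filter.Tendsto (fun m => ‖bet m (2*m) T‖) Filter.atTop (nhds 0) := by
  obtain ⟨N, f, z, h⟩ := fin_rank T hT
  have hb : ∀ m, ‖bet m (2*m) T‖ ≤ (∑ i, ‖f i‖ * ‖z i‖) * (1/4)^m := by
    intro m
    have : bet m (2*m) T = ∑ i, bet m (2*m) ((f i).smulRight (z i)) := by
      unfold bet
      rw [← Finset.mul_sum, Finset.sum_comm]
      congr 1
      refine Finset.sum_congr rfl fun s _ => ?_
      rw [h, sum_apply, map_sum]
    rw [this, Finset.sum_mul]
    exact (norm_sum_le _ _).trans (Finset.sum_le_sum fun i _ => bet_rank1 m _ _)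
  refine squeeze_zero (fun _ => norm_nonneg _) hb ?_
  rw [← mul_zero (∑ i, ‖f i‖ * ‖z i‖)]
  exact (tendsto_pow_atTop_nhds_zero_of_lt_one (by norm_num) (by norm_num)).const_mul _

end APC

namespace APC

variable {𝕜 : Type*} [RCLike 𝕜]

def wt (k : ℕ) : ℝ := √(2^(k/2)) * ((k:ℝ)+1)^2

lemma wt_pos (k : ℕ) : 0 < wt k := by unfold wt; positivity

abbrev IX : Type := Σ k : ℕ, EE (k+2) × (La k → Bool)

def yy (x : IX) : ZZ 𝕜 := ((wt x.1 : ℝ) : 𝕜) • Dl x.1 x.2.1.1 (fun l => sb (x.2.2 l))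

lemma yy_norm (x : IX) : ‖(yy x : ZZ 𝕜)‖^2 ≤ ((x.1:ℝ)+1)^4 * (1/2)^(dd x.1) := by
  obtain ⟨k, i, ε⟩ := x
  unfold yy
  simp only
  rw [norm_smul, RCLike.norm_ofReal, abs_of_pos (wt_pos k), mul_pow]
  calc _ ≤ wt k^2 * (2^(k/2 - dd k) / 4^(k/2)) := by
        gcongr; exact Dl_norm k _ _ (fun l => (sb_norm _).le)
    _ = _ := by
        unfold wt
        rw [mul_pow, Real.sq_sqrt (by positivity)]
        have hB : k/2 = (k/2 - dd k) + dd k := by unfold dd; omega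
        have h4 : (4:ℝ)^(k/2) = 2^(k/2) * 2^(k/2) := by rw [← mul_pow]; norm_num
        have h2 : (2:ℝ)^(k/2) = 2^(k/2 - dd k) * 2^(dd k) := by rw [← pow_add, ← hB]
        rw [h4]
        have : (2:ℝ)^(k/2 - dd k) / (2^(k/2) * 2^(k/2)) = (1/2^(dd k)) / 2^(k/2) := by
          rw [div_eq_div_iff (by positivity) (by positivity), h2]; field_simp
        rw [this, div_pow, one_pow]
        field_simp

lemma lim_u : Filter.Tendsto (fun k : ℕ => ((k:ℝ)+1)^4 * (1/2)^(dd k)) Filter.atTop (nhds 0) := by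
  have h1 : Filter.Tendsto (fun n : ℕ => (n:ℝ)^4 * (1/2)^n) Filter.atTop (nhds 0) :=
    tendsto_pow_const_mul_const_pow_of_abs_lt_one 4 (by rw [abs_of_pos] <;> norm_num)
  have h2 := (h1.comp (Filter.tendsto_add_atTop_nat 1)).const_mul (2 * 8^4)
  have hdd : Filter.Tendsto dd Filter.atTop Filter.atTop := by
    apply Filter.tendsto_atTop_atTop.2
    intro b
    exact ⟨8*b, fun a ha => by unfold dd; omega⟩
  have h3 := h2.comp hdd
  rw [mul_zero] at h3
  refine squeeze_zero (fun _ => by positivity) (fun k => ?_) h3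
  simp only [Function.comp_apply]
  have hk : (k:ℝ) + 1 ≤ 8 * ((dd k + 1 : ℕ) : ℝ) := by
    have : k + 1 ≤ 8 * (dd k + 1) := by unfold dd; omega
    exact_mod_cast this
  calc ((k:ℝ)+1)^4 * (1/2)^(dd k) ≤ (8 * ((dd k + 1 : ℕ) : ℝ))^4 * (1/2)^(dd k) := by gcongr
    _ = _ := by rw [pow_succ (1/2 : ℝ)]; ring

lemma yy_tendsto : Filter.Tendsto (yy : IX → ZZ 𝕜) Filter.cofinite (nhds 0) := by
  rw [tendsto_zero_iff_norm_tendsto_zero]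
  have hfst : Filter.Tendsto (fun x : IX => x.1) Filter.cofinite Filter.atTop := by
    rw [← Nat.cofinite_eq_atTop]
    intro s hs
    rw [Filter.mem_cofinite] at hs
    rw [Filter.mem_map, Filter.mem_cofinite]
    have : ((fun x : IX => x.1) ⁻¹' s)ᶜ = ⋃ k ∈ sᶜ, Set.range (fun y => (⟨k, y⟩ : IX)) := by
      ext ⟨k, y⟩
      simp only [Set.mem_compl_iff, Set.mem_preimage, Set.mem_iUnion, Set.mem_range, exists_prop]
      constructor
      · intro h; exact ⟨k, h, y, rfl⟩
      · rintro ⟨k', h, y', he⟩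
        cases he; exact h
    rw [this]
    exact hs.biUnion fun k _ => Set.finite_range _
  have h := lim_u.comp hfst
  have h2 : Filter.Tendsto (fun x : IX => ‖(yy x : ZZ 𝕜)‖^2) Filter.cofinite (nhds 0) :=
    squeeze_zero (fun _ => by positivity) yy_norm h
  have h3 := h2.sqrt
  simpa using h3

theorem not_ap_ZZ : ¬ HasAP 𝕜 (ZZ 𝕜) := by
  intro hAP
  have hsum : Summable (fun k : ℕ => 1 / ((k:ℝ)+1)^2) := by
    have := (summable_nat_add_iff 1).2 (Real.summable_one_div_nat_pow.2 (one_lt_two))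
    simpa using this
  set S := ∑' k : ℕ, 1 / ((k:ℝ)+1)^2 with hS
  have hS0 : 0 ≤ S := tsum_nonneg fun k => by positivity
  have hK : IsCompact ((insert 0 (Set.range (yy : IX → ZZ 𝕜))) ∪ Set.range (fun i : EE 1 => (X 1 i.1 : ZZ 𝕜))) :=
    (yy_tendsto.isCompact_insert_range_of_cofinite).union (Set.finite_range _).isCompact
  obtain ⟨T, hT, hTK⟩ := hAP _ hK (1/(2*(1+2*S))) (by positivity)
  set δ : ℝ := 1/(2*(1+2*S)) with hδ
  have hδ0 : 0 < δ := by positivity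
  set R : ZZ 𝕜 →L[𝕜] ZZ 𝕜 := T - ContinuousLinearMap.id 𝕜 (ZZ 𝕜) with hR
  have hRx : ∀ x, R x = T x - x := fun x => rfl
  have hstart : ∀ m, ‖bet m 1 R‖ ≤ δ := by
    intro m
    refine bet_start m R δ fun i => ?_
    have : (X 1 i : ZZ 𝕜) = X 1 (tr 1 i).1 := X_congr fun j hj => (tr_eq i hj).symm
    rw [this, hRx]
    exact (hTK _ (Or.inr ⟨_, rfl⟩)).le
  have hstep : ∀ m k, k + 2 ≤ 2*m → ‖bet m (k+1) R - bet m (k+2) R‖ ≤ 2 * δ * (1/((k:ℝ)+1)^2) := by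
    intro m k hk
    have := bet_step m k hk R (δ / wt k) (fun i ε => by
      rw [Dl_tr, le_div_iff₀ (wt_pos k)]
      have h := (hTK _ (Or.inl (Or.inr ⟨⟨k, tr (k+2) i, ε⟩, rfl⟩))).le
      rw [← hRx] at h
      unfold yy at h
      rw [map_smul, norm_smul, RCLike.norm_ofReal, abs_of_pos (wt_pos k)] at h
      rw [mul_comm]; exact h)
    refine this.trans (le_of_eq ?_)
    have : (0:ℝ) < √(2^(k/2)) := by positivity
    unfold wt
    field_simp
  have htot : ∀ m, ∀ n, n + 1 ≤ 2*m → ‖bet m (n+1) R‖ ≤ δ + 2 * δ * ∑ k ∈ Finset.range n, 1/((k:ℝ)+1)^2 := by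
    intro m n
    induction n with
    | zero => intro _; simpa using hstart m
    | succ n ih =>
      intro hn
      have h1 := ih (by omega)
      have h2 := hstep m n (by omega)
      rw [norm_sub_rev] at h2
      rw [Finset.sum_range_succ, mul_add]
      have := norm_le_norm_add_norm_sub (bet m (n+1) R) (bet m (n+1+1) R)
      rw [norm_sub_rev] at this
      linarith
  have hfin : ∀ m, 1 ≤ m → ‖bet m (2*m) R‖ ≤ 1/2 := by
    intro m hm
    have h := htot m (2*m-1) (by omega)
    rw [show 2*m-1+1 = 2*m by omega] at h
    refine h.trans ?_
    have hle : ∑ k ∈ Finset.range (2*m-1), 1/((k:ℝ)+1)^2 ≤ S :=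
      hsum.sum_le_tsum _ (fun k _ => by positivity)
    calc _ ≤ δ + 2 * δ * S := by gcongr
      _ = 1/2 := by rw [hδ]; field_simp
  have hend := bet_end T hT
  have hge : ∀ m, 1 ≤ m → (1:ℝ)/2 ≤ ‖bet m (2*m) T‖ := by
    intro m hm
    have h := hfin m hm
    rw [hR, bet_sub, bet_id m (2*m) le_rfl, norm_sub_rev] at h
    have := norm_sub_norm_le (1:𝕜) (bet m (2*m) T)
    rw [norm_one] at this
    linarith
  have := ge_of_tendsto hend (Filter.eventually_atTop.2 ⟨1, hge⟩)
  norm_num at this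

end APC

namespace APC

variable {𝕜 : Type*} [RCLike 𝕜]

lemma HasAP_retract {A B : Type*} [NormedAddCommGroup A] [NormedSpace 𝕜 A] [NormedAddCommGroup B]
    [NormedSpace 𝕜 B] (J : B →L[𝕜] A) (Q : A →L[𝕜] B) (h : ∀ z, Q (J z) = z) (hA : HasAP 𝕜 A) :
    HasAP 𝕜 B := by
  intro K hK ε hε
  obtain ⟨T, hT, hTK⟩ := hA (J '' K) (hK.image J.continuous) (ε / (‖Q‖ + 1)) (by positivity)
  refine ⟨Q.comp (T.comp J), ?_, ?_⟩
  · have hle : LinearMap.range ((Q.comp (T.comp J) : B →L[𝕜] B) : B →ₗ[𝕜] B) ≤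
        (LinearMap.range (T : A →ₗ[𝕜] A)).map (Q : A →ₗ[𝕜] B) := by
      rintro _ ⟨x, rfl⟩
      exact ⟨T (J x), ⟨J x, rfl⟩, rfl⟩
    exact Submodule.finiteDimensional_of_le hle
  · intro x hx
    have h1 := hTK _ ⟨x, hx, rfl⟩
    have e : (Q.comp (T.comp J)) x - x = Q (T (J x) - J x) := by
      rw [map_sub, h]; rfl
    rw [e]
    rw [lt_div_iff₀ (by positivity)] at h1
    refine (Q.le_opNorm _).trans_lt ?_
    have := norm_nonneg (T (J x) - J x)
    nlinarith

section poly
variable {E F : Type*} [NormedAddCommGroup E] [NormedSpace 𝕜 E] [NormedAddCommGroup F] [NormedSpace 𝕜 F]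

lemma prod_upd {n : ℕ} (φ : E → 𝕜) (s : Finset (Fin n)) (v : Fin n → E) (k : Fin n) (x : E) :
    ∏ j ∈ s, φ (Function.update v k x j) =
      (if k ∈ s then φ x else 1) * ∏ j ∈ s.erase k, φ (v j) := by
  split_ifs with h
  · rw [← Finset.mul_prod_erase s _ h, Function.update_self]
    congr 1
    refine Finset.prod_congr rfl fun j hj => ?_
    rw [Function.update_of_ne (Finset.ne_of_mem_erase hj)]
  · rw [one_mul, Finset.erase_eq_of_notMem h]
    refine Finset.prod_congr rfl fun j hj => ?_
    rw [Function.update_of_ne]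
    rintro rfl; exact h hj

def Mi {n : ℕ} (φ : E →L[𝕜] 𝕜) (i : Fin n) (T : E →L[𝕜] F) :
    ContinuousMultilinearMap 𝕜 (fun _ : Fin n => E) F :=
  MultilinearMap.mkContinuous
    { toFun := fun v => (∏ j ∈ Finset.univ.erase i, φ (v j)) • T (v i)
      map_update_add' := by
        intro _ v k x y
        have : (‹DecidableEq (Fin n)›) = instDecidableEqFin n := Subsingleton.elim _ _
        subst this
        simp only [prod_upd]
        by_cases h : k = i
        · subst h; simp [smul_add]
        · simp [h, Function.update_of_ne (Ne.symm h), add_mul, add_smul]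
      map_update_smul' := by
        intro _ v k c x
        have : (‹DecidableEq (Fin n)›) = instDecidableEqFin n := Subsingleton.elim _ _
        subst this
        simp only [prod_upd]
        by_cases h : k = i
        · subst h; simp only [Function.update_self, map_smul]; rw [smul_comm]; simp
        · simp [h, Function.update_of_ne (Ne.symm h), mul_smul] }
    (‖φ‖^(n-1) * ‖T‖) (by
      intro v
      change ‖(∏ j ∈ Finset.univ.erase i, φ (v j)) • T (v i)‖ ≤ _
      rw [norm_smul, norm_prod, ← Finset.mul_prod_erase Finset.univ _ (Finset.mem_univ i)]
      have h1 : ∏ j ∈ Finset.univ.erase i, ‖φ (v j)‖ ≤ ‖φ‖^(n-1) * ∏ j ∈ Finset.univ.erase i, ‖v j‖ := by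
        calc _ ≤ ∏ j ∈ Finset.univ.erase i, (‖φ‖ * ‖v j‖) :=
              Finset.prod_le_prod (fun _ _ => norm_nonneg _) (fun j _ => φ.le_opNorm _)
          _ = _ := by
              rw [Finset.prod_mul_distrib, Finset.prod_const, Finset.card_erase_of_mem (Finset.mem_univ _)]
              simp
      calc _ ≤ (‖φ‖^(n-1) * ∏ j ∈ Finset.univ.erase i, ‖v j‖) * (‖T‖ * ‖v i‖) := by
            gcongr; exact T.le_opNorm _
        _ = _ := by ring)

lemma Mi_apply {n : ℕ} (φ : E →L[𝕜] 𝕜) (i : Fin n) (T : E →L[𝕜] F) (v : Fin n → E) :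
    Mi φ i T v = (∏ j ∈ Finset.univ.erase i, φ (v j)) • T (v i) := rfl

lemma Mi_norm {n : ℕ} (φ : E →L[𝕜] 𝕜) (i : Fin n) (T : E →L[𝕜] F) :
    ‖Mi φ i T‖ ≤ ‖φ‖^(n-1) * ‖T‖ := MultilinearMap.mkContinuous_norm_le _ (by positivity) _

def MiL {n : ℕ} (φ : E →L[𝕜] 𝕜) (i : Fin n) :
    (E →L[𝕜] F) →L[𝕜] ContinuousMultilinearMap 𝕜 (fun _ : Fin n => E) F :=
  LinearMap.mkContinuous
    { toFun := Mi φ i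
      map_add' := by
        intro S T; ext v
        simp only [add_apply, Mi_apply, smul_add]
      map_smul' := by
        intro c T; ext v
        simp only [Mi_apply, smul_apply, RingHom.id_apply]
        rw [smul_comm] }
    (‖φ‖^(n-1)) (Mi_norm φ i)

def JJ (n : ℕ) (φ : E →L[𝕜] 𝕜) : (E →L[𝕜] F) →L[𝕜] HomPoly 𝕜 n E F :=
  ((n:𝕜)⁻¹ • ∑ i, MiL φ i : (E →L[𝕜] F) →L[𝕜] ContinuousMultilinearMap 𝕜 (fun _ : Fin n => E) F).codRestrict
    (SymmCM 𝕜 n E F) (by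
      intro T σ v
      simp only [smul_apply, sum_apply]
      congr 1
      change ∑ i, Mi φ i T (v ∘ σ) = ∑ i, Mi φ i T v
      rw [← Equiv.sum_comp σ (fun i => Mi φ i T v)]
      refine Finset.sum_congr rfl fun i _ => ?_
      simp only [Mi_apply, Function.comp_apply]
      congr 1
      refine Finset.prod_nbij σ ?_ σ.injective.injOn ?_ (fun _ _ => rfl)
      · intro j hj
        simpa using hj
      · intro j hj
        refine ⟨σ.symm j, ?_, by simp⟩
        simp only [Finset.coe_erase, Finset.coe_univ, Set.mem_sdiff, Set.mem_univ, true_and, Set.mem_singleton_iff] at hj ⊢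
        intro h; apply hj; rw [← h]; simp)

lemma JJ_apply (n : ℕ) (φ : E →L[𝕜] 𝕜) (T : E →L[𝕜] F) (v : Fin n → E) :
    (JJ n φ T : ContinuousMultilinearMap 𝕜 (fun _ : Fin n => E) F) v =
      (n:𝕜)⁻¹ • ∑ i, (∏ j ∈ Finset.univ.erase i, φ (v j)) • T (v i) := by
  change ((n:𝕜)⁻¹ • ∑ i, MiL φ i : (E →L[𝕜] F) →L[𝕜] ContinuousMultilinearMap 𝕜 (fun _ : Fin n => E) F) T v = _
  simp only [smul_apply, sum_apply]
  rfl

def slot {n : ℕ} (i0 : Fin n) (e : E) :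
    HomPoly 𝕜 n E F →L[𝕜] (E →L[𝕜] F) :=
  LinearMap.mkContinuous
    { toFun := fun A => A.1.toContinuousLinearMap (fun _ => e) i0
      map_add' := by intro A B; ext x; rfl
      map_smul' := by intro c A; ext x; rfl }
    (‖e‖^(n-1)) (by
      intro A
      refine ContinuousLinearMap.opNorm_le_bound _ (by positivity) fun x => ?_
      change ‖A.1 (Function.update (fun _ => e) i0 x)‖ ≤ _
      refine (A.1.le_opNorm _).trans (le_of_eq ?_)
      rw [← Finset.mul_prod_erase Finset.univ _ (Finset.mem_univ i0), Function.update_self]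
      rw [Finset.prod_congr rfl (g := fun _ => ‖e‖) (fun j hj => by
        rw [Function.update_of_ne (Finset.ne_of_mem_erase hj)])]
      rw [Finset.prod_const, Finset.card_erase_of_mem (Finset.mem_univ _)]
      simp only [Finset.card_univ, Fintype.card_fin]
      have haux : ∀ a b : ℝ, a = b → a * (‖x‖ * ‖e‖^(n-1)) = ‖e‖^(n-1) * b * ‖x‖ := by
        rintro a _ rfl; ring
      exact haux _ _ rfl)

lemma slot_apply {n : ℕ} (i0 : Fin n) (e : E) (A : HomPoly 𝕜 n E F) (x : E) :
    slot i0 e A x = A.1 (Function.update (fun _ => e) i0 x) := rfl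

lemma slot_JJ (n : ℕ) (i0 : Fin n) (φ : E →L[𝕜] 𝕜) (e : E) (he : φ e = 1) (T : E →L[𝕜] F) (x : E) :
    slot i0 e (JJ n φ T) x = (n:𝕜)⁻¹ • (T x + ((n:𝕜) - 1) • φ x • T e) := by
  rw [slot_apply, JJ_apply]
  congr 1
  rw [← Finset.add_sum_erase Finset.univ _ (Finset.mem_univ i0)]
  have h1 : ∀ i ∈ Finset.univ.erase i0, (∏ j ∈ Finset.univ.erase i, φ (Function.update (fun _ => e) i0 x j)) •
      T (Function.update (fun _ => e) i0 x i) = φ x • T e := by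
    intro i hi
    have hne := Finset.ne_of_mem_erase hi
    have hm : i0 ∈ Finset.univ.erase i := by simp [Ne.symm hne]
    rw [prod_upd (fun x => φ x), if_pos hm, Function.update_of_ne hne]
    simp [he]
  rw [Finset.sum_congr rfl h1, prod_upd (fun x => φ x), if_neg (by simp), Function.update_self]
  have hn : 1 ≤ n := by have := i0.2; omega
  simp only [he, Finset.prod_const_one, one_smul, mul_one, Finset.sum_const,
    Finset.card_erase_of_mem (Finset.mem_univ i0), Finset.card_univ, Fintype.card_fin]
  rw [← Nat.cast_smul_eq_nsmul 𝕜, Nat.cast_sub hn, Nat.cast_one]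

lemma poly_retract (n : ℕ) (hn : 1 ≤ n) (e : E) (he : e ≠ 0) (hA : HasAP 𝕜 (HomPoly 𝕜 n E F)) :
    HasAP 𝕜 (E →L[𝕜] F) := by
  obtain ⟨φ, hφ⟩ := SeparatingDual.exists_eq_one (R := 𝕜) he
  let i0 : Fin n := ⟨0, hn⟩
  let Q : HomPoly 𝕜 n E F →L[𝕜] (E →L[𝕜] F) := (n:𝕜) • slot i0 e -
    ((n:𝕜) - 1) • ((ContinuousLinearMap.smulRightL 𝕜 E F φ).comp
      ((ContinuousLinearMap.apply 𝕜 F e).comp (slot i0 e)))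
  refine HasAP_retract (JJ n φ) Q (fun T => ?_) hA
  ext x
  change (n:𝕜) • slot i0 e (JJ n φ T) x - ((n:𝕜) - 1) • (φ x • slot i0 e (JJ n φ T) e) = T x
  have h0 : (n:𝕜) ≠ 0 := by exact_mod_cast (by omega : n ≠ 0)
  rw [slot_JJ n i0 φ e hφ, slot_JJ n i0 φ e hφ, smul_smul, mul_inv_cancel₀ h0, one_smul, hφ, one_smul]
  have : T e + ((n:𝕜) - 1) • T e = (n:𝕜) • T e := by
    rw [sub_smul, one_smul]; abel
  rw [this, smul_smul (n:𝕜)⁻¹, inv_mul_cancel₀ h0, one_smul, add_sub_cancel_right]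

lemma op_retract {G H : Type*} [NormedAddCommGroup G] [NormedSpace 𝕜 G] [NormedAddCommGroup H] [NormedSpace 𝕜 H]
    (A : G →L[𝕜] E) (B : E →L[𝕜] G) (hAB : B.comp A = ContinuousLinearMap.id 𝕜 G)
    (A' : H →L[𝕜] F) (B' : F →L[𝕜] H) (hAB' : B'.comp A' = ContinuousLinearMap.id 𝕜 H)
    (h : HasAP 𝕜 (E →L[𝕜] F)) : HasAP 𝕜 (G →L[𝕜] H) := by
  refine HasAP_retract ((ContinuousLinearMap.compL 𝕜 E H F A').comp ((ContinuousLinearMap.compL 𝕜 E G H).flip B))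
    ((ContinuousLinearMap.compL 𝕜 G F H B').comp ((ContinuousLinearMap.compL 𝕜 G E F).flip A)) (fun T => ?_) h
  ext x
  change B' (A' (T (B (A x)))) = T x
  have h1 : B (A x) = x := congrArg (fun f : G →L[𝕜] G => f x) hAB
  have h2 : ∀ y, B' (A' y) = y := fun y => congrArg (fun f : H →L[𝕜] H => f y) hAB'
  rw [h1, h2]

end poly
end APC

namespace APC

lemma rpow_le_exp (s : ℝ) (hs : 0 < s) : ∃ C : ℝ, 0 ≤ C ∧ ∀ x : ℝ, |x| ^ s ≤ C * (Real.exp x + Real.exp (-x)) := by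
  obtain ⟨n, hn⟩ := exists_nat_ge s
  refine ⟨1 + n.factorial, by positivity, fun x => ?_⟩
  have h0 := abs_nonneg x
  have h1 : |x| ^ s ≤ 1 + |x| ^ n := by
    rcases le_total |x| 1 with h | h
    · have := Real.rpow_le_one h0 h hs.le
      have : 0 ≤ |x| ^ n := by positivity
      linarith
    · have := Real.rpow_le_rpow_of_exponent_le h hn
      rw [Real.rpow_natCast] at this
      linarith
  have h2 := Real.pow_div_factorial_le_exp _ h0 n
  rw [div_le_iff₀ (by positivity)] at h2
  have h3 : Real.exp |x| ≤ Real.exp x + Real.exp (-x) := by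
    rcases abs_cases x with ⟨h, _⟩ | ⟨h, _⟩ <;> rw [h]
    · linarith [Real.exp_pos (-x)]
    · linarith [Real.exp_pos x]
  have h4 := Real.one_le_exp h0
  have h5 : (0:ℝ) ≤ n.factorial := by positivity
  nlinarith

lemma exp_sum {ι : Type*} [Fintype ι] [DecidableEq ι] (a : ι → ℝ) (ha : ∑ k, a k ^ 2 ≤ 1) :
    ∑ ε : ι → Bool, Real.exp (∑ k, a k * sb (ε k)) ≤ 2 ^ Fintype.card ι * Real.exp (1/2) := by
  have h1 : ∑ ε : ι → Bool, Real.exp (∑ k, a k * sb (ε k)) = ∏ k, (2 * Real.cosh (a k)) := by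
    have := Finset.prod_univ_sum (fun _ : ι => (Finset.univ : Finset Bool))
      (fun k b => Real.exp (a k * sb b))
    rw [Fintype.piFinset_univ] at this
    simp_rw [Real.exp_sum]
    rw [← this]
    refine Finset.prod_congr rfl fun k _ => ?_
    simp [sb, Real.cosh_eq]
    ring
  rw [h1, Finset.prod_mul_distrib, Finset.prod_const, Finset.card_univ]
  gcongr
  calc ∏ k, Real.cosh (a k) ≤ ∏ k, Real.exp (a k ^ 2 / 2) :=
        Finset.prod_le_prod (fun k _ => (Real.cosh_pos _).le) (fun k _ => Real.cosh_le_exp_half_sq _)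
    _ = Real.exp (∑ k, a k ^ 2 / 2) := (Real.exp_sum _ _).symm
    _ ≤ _ := by
      rw [← Finset.sum_div]
      apply Real.exp_le_exp.2
      linarith

lemma khin_real (s : ℝ) (hs : 0 < s) : ∃ C : ℝ, 0 ≤ C ∧ ∀ (ι : Type) [Fintype ι] [DecidableEq ι]
    (a : ι → ℝ), ∑ k, a k ^ 2 ≤ 1 →
    ∑ ε : ι → Bool, |∑ k, a k * sb (ε k)| ^ s ≤ 2 ^ Fintype.card ι * C := by
  obtain ⟨C, hC, h⟩ := rpow_le_exp s hs
  refine ⟨C * (Real.exp (1/2) + Real.exp (1/2)), by positivity, fun ι _ _ a ha => ?_⟩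
  have h1 := exp_sum a ha
  have h2 := exp_sum (fun k => - a k) (by simpa using ha)
  simp only [neg_mul, Finset.sum_neg_distrib] at h2
  calc _ ≤ ∑ ε : ι → Bool, C * (Real.exp (∑ k, a k * sb (ε k)) + Real.exp (-∑ k, a k * sb (ε k))) :=
        Finset.sum_le_sum fun ε _ => h _
    _ = C * (∑ ε : ι → Bool, Real.exp (∑ k, a k * sb (ε k)) + ∑ ε : ι → Bool, Real.exp (-∑ k, a k * sb (ε k))) := by
        rw [← Finset.mul_sum, Finset.sum_add_distrib]
    _ ≤ C * (2 ^ Fintype.card ι * Real.exp (1/2) + 2 ^ Fintype.card ι * Real.exp (1/2)) := by gcongr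
    _ = _ := by ring

variable {𝕜 : Type*} [RCLike 𝕜]

lemma add_rpow_le (s : ℝ) (hs : 0 < s) (x y : ℝ) (hx : 0 ≤ x) (hy : 0 ≤ y) :
    (x + y) ^ s ≤ 2 ^ s * (x ^ s + y ^ s) := by
  have hxs : 0 ≤ x ^ s := by positivity
  have hys : 0 ≤ y ^ s := by positivity
  have h2 : (0:ℝ) ≤ 2 ^ s := by positivity
  rcases le_total x y with h | h
  · calc (x+y)^s ≤ (2*y)^s := Real.rpow_le_rpow (by positivity) (by linarith) hs.le
      _ = 2^s * y^s := Real.mul_rpow (by norm_num) hy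
      _ ≤ _ := by gcongr; linarith
  · calc (x+y)^s ≤ (2*x)^s := Real.rpow_le_rpow (by positivity) (by linarith) hs.le
      _ = 2^s * x^s := Real.mul_rpow (by norm_num) hx
      _ ≤ _ := by gcongr; linarith

lemma sb_cast (b : Bool) : (sb b : 𝕜) = ((sb b : ℝ) : 𝕜) := by cases b <;> simp [sb]

lemma norm_re_im (z : 𝕜) : ‖z‖ ≤ |RCLike.re z| + |RCLike.im z| := by
  conv_lhs => rw [← RCLike.re_add_im z]
  refine (norm_add_le _ _).trans ?_
  rw [norm_mul, RCLike.norm_ofReal, RCLike.norm_ofReal]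
  have : ‖(RCLike.I : 𝕜)‖ ≤ 1 := by rw [RCLike.norm_I]; split_ifs <;> norm_num
  have := mul_le_of_le_one_right (abs_nonneg (RCLike.im z)) this
  linarith

lemma khin1 (s : ℝ) (hs : 0 < s) : ∃ C : ℝ, 0 ≤ C ∧ ∀ (ι : Type) [Fintype ι] [DecidableEq ι]
    (a : EuclideanSpace 𝕜 ι), ‖a‖ ≤ 1 →
    ∑ ε : ι → Bool, ‖∑ k, a k * sb (ε k)‖ ^ s ≤ 2 ^ Fintype.card ι * C := by
  obtain ⟨C, hC, h⟩ := khin_real s hs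
  refine ⟨2 ^ s * (C + C), by positivity, fun ι _ _ a ha => ?_⟩
  have hsq : ∑ k, ‖a k‖ ^ 2 ≤ 1 := by
    rw [← EuclideanSpace.norm_sq_eq]
    have := norm_nonneg a
    nlinarith
  have hr := h ι (fun k => RCLike.re (a k)) ((Finset.sum_le_sum fun k _ => by
    rw [← sq_abs]; gcongr; exact RCLike.abs_re_le_norm _).trans hsq)
  have hi := h ι (fun k => RCLike.im (a k)) ((Finset.sum_le_sum fun k _ => by
    rw [← sq_abs]; gcongr; exact RCLike.abs_im_le_norm _).trans hsq)
  have key : ∀ ε : ι → Bool, ‖∑ k, a k * sb (ε k)‖ ^ s ≤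
      2 ^ s * (|∑ k, RCLike.re (a k) * sb (ε k)| ^ s + |∑ k, RCLike.im (a k) * sb (ε k)| ^ s) := by
    intro ε
    refine le_trans ?_ (add_rpow_le s hs _ _ (abs_nonneg _) (abs_nonneg _))
    refine Real.rpow_le_rpow (norm_nonneg _) ?_ hs.le
    refine (norm_re_im _).trans (le_of_eq ?_)
    simp only [map_sum, sb_cast (𝕜 := 𝕜), RCLike.re_mul_ofReal, RCLike.im_mul_ofReal]
  calc _ ≤ _ := Finset.sum_le_sum fun ε _ => key ε
    _ = 2 ^ s * (∑ ε : ι → Bool, |∑ k, RCLike.re (a k) * sb (ε k)| ^ s + ∑ ε : ι → Bool, |∑ k, RCLike.im (a k) * sb (ε k)| ^ s) := by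
      rw [← Finset.mul_sum, Finset.sum_add_distrib]
    _ ≤ 2 ^ s * (2 ^ Fintype.card ι * C + 2 ^ Fintype.card ι * C) := by gcongr
    _ = _ := by ring

variable (𝕜) in
lemma khin (s : ℝ) (hs : 0 < s) : ∃ K : ℝ, 0 ≤ K ∧ ∀ (ι : Type) [Fintype ι] [DecidableEq ι]
    (a : EuclideanSpace 𝕜 ι),
    ∑ ε : ι → Bool, ‖∑ k, a k * sb (ε k)‖ ^ s ≤ 2 ^ Fintype.card ι * (K * ‖a‖) ^ s := by
  obtain ⟨C, hC, h⟩ := khin1 (𝕜 := 𝕜) s hs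
  refine ⟨C ^ (1/s), by positivity, fun ι _ _ a => ?_⟩
  rw [Real.mul_rpow (by positivity) (norm_nonneg _), ← Real.rpow_mul hC, one_div_mul_cancel hs.ne', Real.rpow_one]
  by_cases ha : a = 0
  · subst ha
    simp [Real.zero_rpow hs.ne']
  have hn : 0 < ‖a‖ := norm_pos_iff.2 ha
  have h1 := h ι (((‖a‖⁻¹ : ℝ) : 𝕜) • a) (by
    rw [norm_smul, RCLike.norm_ofReal, abs_of_pos (by positivity), inv_mul_cancel₀ hn.ne'])
  have e : ∀ ε : ι → Bool, ‖∑ k, (((‖a‖⁻¹ : ℝ) : 𝕜) • a) k * sb (ε k)‖ ^ s =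
      (‖a‖⁻¹) ^ s * ‖∑ k, a k * sb (ε k)‖ ^ s := by
    intro ε
    simp only [PiLp.smul_apply, smul_eq_mul, mul_assoc]
    rw [← Finset.mul_sum, norm_mul, RCLike.norm_ofReal, abs_of_pos (by positivity), Real.mul_rpow (by positivity) (norm_nonneg _)]
  simp only [e] at h1
  rw [← Finset.mul_sum, Real.inv_rpow hn.le] at h1
  have : 0 < ‖a‖ ^ s := by positivity
  rw [inv_mul_le_iff₀ this] at h1
  linarith

end APC

namespace APC
variable {𝕜 : Type*} [RCLike 𝕜]
variable {ι : Type} [Fintype ι] [DecidableEq ι]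

variable (ι) in
def NN : ℝ := 2 ^ Fintype.card ι
lemma NN_pos : 0 < NN ι := by unfold NN; positivity

def ii (s : ℝ) (a : EuclideanSpace 𝕜 ι) (ε : ι → Bool) : 𝕜 :=
  ((NN ι ^ (-(1/s)) : ℝ) : 𝕜) * ∑ k, a k * sb (ε k)

def rr (s : ℝ) (f : (ι → Bool) → 𝕜) : EuclideanSpace 𝕜 ι :=
  WithLp.toLp 2 fun k => ((NN ι ^ (1/s - 1) : ℝ) : 𝕜) * ∑ ε, f ε * sb (ε k)

lemma ii_add (s : ℝ) (a b : EuclideanSpace 𝕜 ι) (ε) : ii s (a + b) ε = ii s a ε + ii s b ε := by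
  simp [ii, add_mul, Finset.sum_add_distrib, mul_add]
lemma ii_smul (s : ℝ) (c : 𝕜) (a : EuclideanSpace 𝕜 ι) (ε) : ii s (c • a) ε = c * ii s a ε := by
  simp only [ii, PiLp.smul_apply, smul_eq_mul, mul_assoc, ← Finset.mul_sum]; ring
lemma rr_add (s : ℝ) (f g : (ι → Bool) → 𝕜) : rr s (fun ε => f ε + g ε) = rr s f + rr s g := by
  ext k; simp [rr, add_mul, Finset.sum_add_distrib, mul_add]
lemma rr_smul (s : ℝ) (c : 𝕜) (f : (ι → Bool) → 𝕜) : rr s (fun ε => c * f ε) = c • rr s f := by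
  ext k; simp only [rr, PiLp.smul_apply, smul_eq_mul, mul_assoc, ← Finset.mul_sum]; ring

lemma rr_ii (s : ℝ) (a : EuclideanSpace 𝕜 ι) : rr s (ii s a) = a := by
  ext k
  simp only [rr, ii]
  have h1 : ∑ ε : ι → Bool, (∑ j, a j * sb (ε j)) * sb (ε k) = ((NN ι : ℝ) : 𝕜) * a k := by
    simp only [Finset.sum_mul]
    rw [Finset.sum_comm]
    simp only [mul_assoc, ← Finset.mul_sum, rad]
    have : ((NN ι : ℝ) : 𝕜) = 2 ^ Fintype.card ι := by unfold NN; push_cast; rfl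
    rw [this]
    simp [mul_comm]
  simp only [mul_assoc, ← Finset.mul_sum]
  rw [h1, ← mul_assoc, ← mul_assoc, ← RCLike.ofReal_mul, ← RCLike.ofReal_mul, ← Real.rpow_add NN_pos,
    show 1/s - 1 + -(1/s) = -1 by ring, Real.rpow_neg_one, inv_mul_cancel₀ NN_pos.ne']
  simp

variable (𝕜) in
lemma ii_bound (s : ℝ) (hs : 0 < s) : ∃ K : ℝ, 0 ≤ K ∧ ∀ (ι : Type) [Fintype ι] [DecidableEq ι]
    (a : EuclideanSpace 𝕜 ι), ∑ ε : ι → Bool, ‖ii s a ε‖ ^ s ≤ K ^ s * ‖a‖ ^ s := by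
  obtain ⟨K, hK, h⟩ := khin 𝕜 s hs
  refine ⟨K, hK, fun ι _ _ a => ?_⟩
  have h := h ι a
  have hN : 0 < NN ι := NN_pos
  rw [← Real.mul_rpow hK (norm_nonneg _)]
  unfold ii
  simp only [norm_mul, RCLike.norm_ofReal]
  have e : ∀ y : ℝ, 0 ≤ y → (|NN ι ^ (-(1/s))| * y) ^ s = (NN ι)⁻¹ * y ^ s := by
    intro y hy
    rw [abs_of_nonneg (by positivity), Real.mul_rpow (by positivity) hy, ← Real.rpow_mul hN.le,
      neg_mul, one_div_mul_cancel hs.ne', Real.rpow_neg_one]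
  simp only [fun ε : ι → Bool => e _ (norm_nonneg (∑ k, a k * sb (ε k)))]
  rw [← Finset.mul_sum, inv_mul_le_iff₀ hN]
  exact h

variable (𝕜) in
lemma rr_bound (s : ℝ) (hs : 1 < s) : ∃ K : ℝ, 0 ≤ K ∧ ∀ (ι : Type) [Fintype ι] [DecidableEq ι]
    (f : (ι → Bool) → 𝕜), ‖rr s f‖ ^ s ≤ K ^ s * ∑ ε, ‖f ε‖ ^ s := by
  have hc := Real.HolderConjugate.conjExponent hs
  set t := Real.conjExponent s with ht
  have ht0 : 0 < t := hc.symm.pos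
  have hs0 : 0 < s := hc.pos
  obtain ⟨K, hK, h⟩ := khin 𝕜 t ht0
  refine ⟨K, hK, fun ι _ _ f => ?_⟩
  have hN : 0 < NN ι := NN_pos
  set b := rr s f with hb
  set b' : EuclideanSpace 𝕜 ι := WithLp.toLp 2 fun k => star (b k) with hb'
  have hnb : ‖b'‖ = ‖b‖ := by
    simp [EuclideanSpace.norm_eq, hb']
  set S := ∑ ε, ‖f ε‖ ^ s with hS
  have hS0 : 0 ≤ S := Finset.sum_nonneg fun _ _ => by positivity
  have main : ‖b‖ ≤ K * S ^ (1/s) := by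
    have h1 : ((‖b‖ ^ 2 : ℝ) : 𝕜) = ((NN ι ^ (1/s - 1) : ℝ) : 𝕜) * ∑ ε, f ε * ∑ k, b' k * sb (ε k) := by
      rw [EuclideanSpace.norm_sq_eq]
      have : ∀ k, ((‖b k‖ ^ 2 : ℝ) : 𝕜) = ((NN ι ^ (1/s - 1) : ℝ) : 𝕜) * ∑ ε, f ε * (b' k * sb (ε k)) := by
        intro k
        have e1 : ((‖b k‖ ^ 2 : ℝ) : 𝕜) = b' k * b k := by
          simp only [hb']
          rw [RCLike.star_def, RCLike.conj_mul]; norm_cast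
        rw [e1]
        conv_lhs => rw [hb]
        simp only [rr]
        rw [← mul_assoc, mul_comm (b' k), mul_assoc, Finset.mul_sum]
        congr 1
        exact Finset.sum_congr rfl fun _ _ => by ring
      rw [RCLike.ofReal_sum]
      simp only [this, ← Finset.mul_sum]
      rw [Finset.sum_comm]
      simp only [← Finset.mul_sum]
    have h2 : ‖b‖ ^ 2 ≤ NN ι ^ (1/s - 1) * ∑ ε, ‖f ε‖ * ‖∑ k, b' k * sb (ε k)‖ := by
      have := congrArg norm h1
      rw [RCLike.norm_ofReal, abs_of_nonneg (by positivity), norm_mul, RCLike.norm_ofReal, abs_of_nonneg (by positivity)] at this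
      rw [this]
      gcongr
      refine (norm_sum_le _ _).trans (le_of_eq ?_)
      simp only [norm_mul]
    have h3 := Real.inner_le_Lp_mul_Lq (Finset.univ : Finset (ι → Bool)) (fun ε => ‖f ε‖)
      (fun ε => ‖∑ k, b' k * sb (ε k)‖) hc
    simp only [abs_norm] at h3
    have h4 : (∑ ε : ι → Bool, ‖∑ k, b' k * sb (ε k)‖ ^ t) ^ (1/t) ≤ NN ι ^ (1/t) * (K * ‖b‖) := by
      have := Real.rpow_le_rpow (Finset.sum_nonneg fun _ _ => by positivity) (h ι b') (z := 1/t) (by positivity)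
      rw [Real.mul_rpow (by positivity) (by positivity), ← Real.rpow_mul (by positivity) t,
        mul_one_div_cancel ht0.ne', Real.rpow_one, hnb] at this
      exact this
    have h5 : ‖b‖ ^ 2 ≤ K * S ^ (1/s) * ‖b‖ := by
      calc ‖b‖ ^ 2 ≤ NN ι ^ (1/s - 1) * (S ^ (1/s) * (NN ι ^ (1/t) * (K * ‖b‖))) := by
            refine h2.trans ?_
            gcongr
            refine h3.trans ?_
            gcongr
        _ = (NN ι ^ (1/s - 1) * NN ι ^ (1/t)) * (K * S ^ (1/s) * ‖b‖) := by ring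
        _ = _ := by
          rw [← Real.rpow_add hN]
          have := hc.inv_add_inv_eq_one
          rw [show 1/s - 1 + 1/t = 0 by simp only [one_div]; linarith, Real.rpow_zero, one_mul]
    rcases (norm_nonneg b).eq_or_lt with h0 | h0
    · rw [← h0]; positivity
    · rw [sq] at h5; exact le_of_mul_le_mul_right h5 h0
  calc ‖b‖ ^ s ≤ (K * S ^ (1/s)) ^ s := Real.rpow_le_rpow (norm_nonneg _) main hs0.le
    _ = _ := by
      rw [Real.mul_rpow hK (by positivity), ← Real.rpow_mul hS0, one_div_mul_cancel hs0.ne', Real.rpow_one]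

end APC

namespace APC
variable {𝕜 : Type*} [RCLike 𝕜]

abbrev WW : Type := Σ m : ℕ, (EE (2*m) → Bool)
instance : Infinite WW := Infinite.of_injective (fun m : ℕ => (⟨m, fun _ => true⟩ : WW))
  (fun _ _ h => congrArg Sigma.fst h)
def eW : WW ≃ ℕ := (nonempty_equiv_of_countable (α := WW) (β := ℕ)).some

abbrev YY (𝕜 : Type*) [RCLike 𝕜] (p : ℝ≥0∞) : Type _ := lp (fun m : ℕ => HH 𝕜 m) p

lemma mk_clm {α β : Type} {X : α → Type*} {Y : β → Type*} [∀ i, NormedAddCommGroup (X i)]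
    [∀ i, NormedSpace 𝕜 (X i)] [∀ i, NormedAddCommGroup (Y i)] [∀ i, NormedSpace 𝕜 (Y i)]
    (p q : ℝ≥0∞) [Fact (1 ≤ p)] [Fact (1 ≤ q)] (hq : 0 < q.toReal) (K : ℝ) (hK : 0 ≤ K)
    (L : (∀ i, X i) → (∀ j, Y j)) (hadd : ∀ f g, L (f + g) = L f + L g)
    (hsmul : ∀ (c : 𝕜) f, L (c • f) = c • L f)
    (hb : ∀ f : lp X p, ∀ s : Finset β, ∑ j ∈ s, ‖L f j‖ ^ q.toReal ≤ (K * ‖f‖) ^ q.toReal) :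
    ∃ T : lp X p →L[𝕜] lp Y q, ∀ f j, T f j = L f j := by
  refine ⟨LinearMap.mkContinuous
    { toFun := fun f => ⟨L f, memℓp_gen' (hb f)⟩
      map_add' := ?_
      map_smul' := ?_ } K ?_, fun f j => rfl⟩
  · intro f g; apply lp.ext; exact hadd f g
  · intro c f; apply lp.ext; exact hsmul c f
  · intro f
    exact lp.norm_le_of_forall_sum_le hq (by positivity) (hb f)

lemma sum_WW (g : WW → ℝ) (t : ℕ → ℝ) (c H : ℝ) (hc : 0 ≤ c) (hg : ∀ w, 0 ≤ g w)
    (h : ∀ m, ∑ ε, g ⟨m, ε⟩ ≤ c * t m) (hH : ∀ S : Finset ℕ, ∑ m ∈ S, t m ≤ H) (s : Finset ℕ) :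
    ∑ n ∈ s, g (eW.symm n) ≤ c * H := by
  set S : Finset ℕ := s.image (fun n => (eW.symm n).1) with hS
  calc ∑ n ∈ s, g (eW.symm n)
      = ∑ w ∈ s.map eW.symm.toEmbedding, g w := by
        rw [Finset.sum_map]; rfl
    _ ≤ ∑ w ∈ S.sigma (fun _ => Finset.univ), g w := by
        refine Finset.sum_le_sum_of_subset_of_nonneg ?_ (fun w _ _ => hg w)
        intro w hw
        simp only [Finset.mem_map, Equiv.coe_toEmbedding] at hw
        obtain ⟨n, hn, rfl⟩ := hw
        simp only [Finset.mem_sigma, Finset.mem_univ, and_true]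
        exact Finset.mem_image_of_mem _ hn
    _ = ∑ m ∈ S, ∑ ε, g ⟨m, ε⟩ := by rw [Finset.sum_sigma]
    _ ≤ ∑ m ∈ S, c * t m := Finset.sum_le_sum fun m _ => h m
    _ = c * ∑ m ∈ S, t m := by rw [Finset.mul_sum]
    _ ≤ c * H := by
        gcongr
        exact hH S

lemma exists_I (p : ℝ≥0∞) [Fact (1 ≤ p)] (hp : 0 < p.toReal) :
    ∃ T : YY 𝕜 p →L[𝕜] lp (fun _ : ℕ => 𝕜) p, ∀ f n, T f n = ii p.toReal (f (eW.symm n).1) (eW.symm n).2 := by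
  obtain ⟨K, hK, h⟩ := ii_bound 𝕜 p.toReal hp
  refine mk_clm (X := fun m : ℕ => HH 𝕜 m) (Y := fun _ : ℕ => 𝕜) p p hp K hK (fun f n => ii p.toReal (f (eW.symm n).1) (eW.symm n).2) ?_ ?_ ?_
  · intro f g; funext n; exact ii_add _ _ _ _
  · intro c f; funext n; exact ii_smul _ _ _ _
  · intro f s
    rw [Real.mul_rpow hK (norm_nonneg _)]
    refine sum_WW (fun w => ‖ii p.toReal (f w.1) w.2‖ ^ p.toReal) (fun m => ‖f m‖ ^ p.toReal) _ _
      (by positivity) (fun w => by positivity) (fun m => h (EE (2*m)) (f m)) (fun S => lp.sum_rpow_le_norm_rpow hp f S) s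

lemma exists_R (p : ℝ≥0∞) [Fact (1 ≤ p)] (hp : 1 < p.toReal) :
    ∃ T : lp (fun _ : ℕ => 𝕜) p →L[𝕜] YY 𝕜 p, ∀ f m, T f m = rr p.toReal (fun ε => f (eW ⟨m, ε⟩)) := by
  obtain ⟨K, hK, h⟩ := rr_bound 𝕜 p.toReal hp
  have hp0 : 0 < p.toReal := by linarith
  refine mk_clm (X := fun _ : ℕ => 𝕜) (Y := fun m : ℕ => HH 𝕜 m) p p hp0 K hK (fun f m => rr p.toReal (fun ε => f (eW ⟨m, ε⟩))) ?_ ?_ ?_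
  · intro f g; funext n; exact rr_add _ _ _
  · intro c f; funext n; exact rr_smul _ _ _
  · intro f S
    calc ∑ m ∈ S, ‖rr p.toReal (fun ε => f (eW ⟨m, ε⟩))‖ ^ p.toReal
        ≤ ∑ m ∈ S, K ^ p.toReal * ∑ ε : EE (2*m) → Bool, ‖f (eW ⟨m, ε⟩)‖ ^ p.toReal :=
          Finset.sum_le_sum fun m _ => h _ _
      _ = K ^ p.toReal * ∑ m ∈ S, ∑ ε : EE (2*m) → Bool, ‖f (eW ⟨m, ε⟩)‖ ^ p.toReal := by rw [Finset.mul_sum]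
      _ = K ^ p.toReal * ∑ w ∈ S.sigma (fun _ => Finset.univ), ‖f (eW w)‖ ^ p.toReal := by
          rw [Finset.sum_sigma]
      _ = K ^ p.toReal * ∑ n ∈ (S.sigma (fun _ => Finset.univ)).map eW.toEmbedding, ‖f n‖ ^ p.toReal := by
          rw [Finset.sum_map]; rfl
      _ ≤ K ^ p.toReal * ‖f‖ ^ p.toReal := by
          gcongr
          exact lp.sum_rpow_le_norm_rpow hp0 f _
      _ = _ := (Real.mul_rpow hK (norm_nonneg _)).symm

variable (𝕜) in
lemma exists_IR (p : ℝ≥0∞) [Fact (1 ≤ p)] (hp : 1 < p.toReal) :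
    ∃ (A : YY 𝕜 p →L[𝕜] lp (fun _ : ℕ => 𝕜) p) (B : lp (fun _ : ℕ => 𝕜) p →L[𝕜] YY 𝕜 p),
      B.comp A = ContinuousLinearMap.id 𝕜 _ := by
  obtain ⟨A, hA⟩ := exists_I (𝕜 := 𝕜) p (by linarith)
  obtain ⟨B, hB⟩ := exists_R (𝕜 := 𝕜) p hp
  refine ⟨A, B, ?_⟩
  refine ContinuousLinearMap.ext fun f => lp.ext (funext fun m => ?_)
  change B (A f) m = f m
  rw [hB]
  have : (fun ε => A f (eW ⟨m, ε⟩)) = ii p.toReal (f m) := by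
    funext ε; rw [hA, Equiv.symm_apply_apply]
  rw [this, rr_ii]

lemma diag_op (p q : ℝ≥0∞) [Fact (1 ≤ p)] [Fact (1 ≤ q)] (hp : 0 < p.toReal) (hpq : p.toReal ≤ q.toReal)
    (hp0 : p ≠ 0) (z : ZZ 𝕜) :
    ∀ f : YY 𝕜 p, ∀ S : Finset ℕ, ∑ m ∈ S, ‖comp z m (f m)‖ ^ q.toReal ≤ (‖z‖ * ‖f‖) ^ q.toReal := by
  intro f S
  have hq : 0 < q.toReal := hp.trans_le hpq
  have h1 : ∀ m, ‖comp z m (f m)‖ ≤ ‖z‖ * ‖f m‖ := fun m =>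
    ((comp z m).le_opNorm _).trans (by gcongr; exact comp_norm z m)
  have h2 : ∀ m, ‖f m‖ ^ q.toReal ≤ ‖f‖ ^ (q.toReal - p.toReal) * ‖f m‖ ^ p.toReal := by
    intro m
    rcases (norm_nonneg (f m)).eq_or_lt with h | h
    · rw [← h, Real.zero_rpow hq.ne', Real.zero_rpow hp.ne', mul_zero]
    · rw [show q.toReal = (q.toReal - p.toReal) + p.toReal by ring, Real.rpow_add h, add_sub_cancel_right]
      refine mul_le_mul_of_nonneg_right ?_ (by positivity)
      exact Real.rpow_le_rpow (norm_nonneg _) (lp.norm_apply_le_norm hp0 f m) (by linarith)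
  calc _ ≤ ∑ m ∈ S, (‖z‖ * ‖f m‖) ^ q.toReal := by gcongr with m _; exact h1 m
    _ = ∑ m ∈ S, ‖z‖ ^ q.toReal * ‖f m‖ ^ q.toReal :=
      Finset.sum_congr rfl fun m _ => Real.mul_rpow (norm_nonneg _) (norm_nonneg _)
    _ = ‖z‖ ^ q.toReal * ∑ m ∈ S, ‖f m‖ ^ q.toReal := by rw [Finset.mul_sum]
    _ ≤ ‖z‖ ^ q.toReal * ∑ m ∈ S, ‖f‖ ^ (q.toReal - p.toReal) * ‖f m‖ ^ p.toReal := by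
      gcongr with m _; exact h2 m
    _ = ‖z‖ ^ q.toReal * (‖f‖ ^ (q.toReal - p.toReal) * ∑ m ∈ S, ‖f m‖ ^ p.toReal) := by
      congr 1; rw [Finset.mul_sum]
    _ ≤ ‖z‖ ^ q.toReal * (‖f‖ ^ (q.toReal - p.toReal) * ‖f‖ ^ p.toReal) := by
      gcongr; exact lp.sum_rpow_le_norm_rpow hp f S
    _ = _ := by
      rw [← Real.rpow_add' (norm_nonneg _) (by rw [sub_add_cancel]; exact hq.ne'), sub_add_cancel,
        Real.mul_rpow (norm_nonneg _) (norm_nonneg _)]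

section
variable (p q : ℝ≥0∞) [Fact (1 ≤ p)] [Fact (1 ≤ q)] (hp : 0 < p.toReal) (hpq : p.toReal ≤ q.toReal)
    (hp0 : p ≠ 0)

def DD (z : ZZ 𝕜) : YY 𝕜 p →L[𝕜] YY 𝕜 q :=
  LinearMap.mkContinuous
    { toFun := fun f => ⟨fun m => comp z m (f m), memℓp_gen' (diag_op p q hp hpq hp0 z f)⟩
      map_add' := fun f g => lp.ext (funext fun m => map_add (comp z m) (f m) (g m))
      map_smul' := fun c f => lp.ext (funext fun m => map_smul (comp z m) c (f m)) } ‖z‖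
    (fun f => lp.norm_le_of_forall_sum_le (hp.trans_le hpq) (by positivity) (diag_op p q hp hpq hp0 z f))

lemma DD_apply (z : ZZ 𝕜) (f : YY 𝕜 p) (m : ℕ) : DD p q hp hpq hp0 z f m = comp z m (f m) := rfl
lemma DD_norm (z : ZZ 𝕜) : ‖DD p q hp hpq hp0 z‖ ≤ ‖z‖ := LinearMap.mkContinuous_norm_le _ (norm_nonneg _) _

def JJb : ZZ 𝕜 →L[𝕜] (YY 𝕜 p →L[𝕜] YY 𝕜 q) :=
  LinearMap.mkContinuous
    { toFun := DD p q hp hpq hp0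
      map_add' := fun z w => by
        refine ContinuousLinearMap.ext fun f => lp.ext (funext fun m => ?_)
        change comp (z + w) m (f m) = comp z m (f m) + comp w m (f m)
        rfl
      map_smul' := fun c z => by
        refine ContinuousLinearMap.ext fun f => lp.ext (funext fun m => ?_)
        change comp (c • z) m (f m) = c • comp z m (f m)
        rfl } 1
    (fun z => by rw [one_mul]; exact DD_norm p q hp hpq hp0 z)

lemma JJb_apply (z : ZZ 𝕜) (f : YY 𝕜 p) (m : ℕ) : JJb p q hp hpq hp0 z f m = comp z m (f m) := rfl

def qq (m : ℕ) (S : YY 𝕜 p →L[𝕜] YY 𝕜 q) : HH 𝕜 m →L[𝕜] HH 𝕜 m :=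
  (lp.evalCLM (p := q) 𝕜 (fun m => HH 𝕜 m) m).comp (S.comp (lp.singleContinuousLinearMap 𝕜 (fun m => HH 𝕜 m) p m))

lemma qq_apply (m : ℕ) (S : YY 𝕜 p →L[𝕜] YY 𝕜 q) (x : HH 𝕜 m) :
    qq p q m S x = S (lp.single p m x) m := rfl

lemma qq_norm (m : ℕ) (S : YY 𝕜 p →L[𝕜] YY 𝕜 q) : ‖qq p q m S‖ ≤ ‖S‖ := by
  refine ContinuousLinearMap.opNorm_le_bound _ (norm_nonneg _) fun x => ?_
  rw [qq_apply]
  have h1 : (1:ℝ≥0∞) ≤ p := Fact.out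
  have h2 : (1:ℝ≥0∞) ≤ q := Fact.out
  refine (lp.norm_apply_le_norm (zero_lt_one.trans_le h2).ne' _ m).trans ?_
  refine (S.le_opNorm _).trans (le_of_eq ?_)
  congr 1
  exact lp.norm_single (E := fun m => HH 𝕜 m) (zero_lt_one.trans_le h1) m x

lemma qq_mem (S : YY 𝕜 p →L[𝕜] YY 𝕜 q) : Memℓp (E := fun m => OP 𝕜 m) (fun m => qq p q m S) ∞ := by
  apply memℓp_infty
  refine ⟨‖S‖, ?_⟩
  rintro _ ⟨m, rfl⟩
  exact qq_norm p q m S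

def QQb : (YY 𝕜 p →L[𝕜] YY 𝕜 q) →L[𝕜] ZZ 𝕜 :=
  LinearMap.mkContinuous
    { toFun := fun S => (⟨fun m => qq p q m S, qq_mem p q S⟩ : ZZ 𝕜)
      map_add' := fun S T => by
        refine lp.ext (funext fun m => ?_)
        change qq p q m (S + T) = qq p q m S + qq p q m T
        refine ContinuousLinearMap.ext fun x => ?_
        rfl
      map_smul' := fun c S => by
        refine lp.ext (funext fun m => ?_)
        change qq p q m (c • S) = c • qq p q m S
        refine ContinuousLinearMap.ext fun x => ?_
        rfl } 1
    (fun S => by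
      rw [one_mul]
      exact lp.norm_le_of_forall_le (norm_nonneg _) (fun m => qq_norm p q m S))

lemma ap_YY (hp : 0 < p.toReal) (hpq : p.toReal ≤ q.toReal) (hp0 : p ≠ 0) (h : HasAP 𝕜 (YY 𝕜 p →L[𝕜] YY 𝕜 q)) : HasAP 𝕜 (ZZ 𝕜) := by
  refine HasAP_retract (JJb p q hp hpq hp0) (QQb p q) (fun z => ?_) h
  refine lp.ext (funext fun m => ?_)
  change qq p q m (JJb p q hp hpq hp0 z) = comp z m
  refine ContinuousLinearMap.ext fun x => ?_
  rw [qq_apply, JJb_apply]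
  congr 1
  exact lp.single_apply_self (E := fun m => HH 𝕜 m) p m x

end
end APC

/-- If `1 < p ≤ q < ∞` and `E`, `F` contain complemented copies of `ℓ_p`, `ℓ_q` respectively,
then `P(ⁿE;F)` fails the approximation property for every `n ≥ 1`. -/
theorem not_ap_vectorPoly (𝕜 : Type*) [RCLike 𝕜] (p q : ℝ≥0∞) [Fact (1 ≤ p)] [Fact (1 ≤ q)]
    (hp : 1 < p) (hpq : p ≤ q) (hq : q < ⊤)
    (E F : Type*) [NormedAddCommGroup E] [NormedSpace 𝕜 E] [CompleteSpace E]
    [NormedAddCommGroup F] [NormedSpace 𝕜 F] [CompleteSpace F]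
    (hE : ∃ (A : lp (fun _ : ℕ => 𝕜) p →L[𝕜] E) (B : E →L[𝕜] lp (fun _ : ℕ => 𝕜) p),
      B.comp A = ContinuousLinearMap.id 𝕜 (lp (fun _ : ℕ => 𝕜) p))
    (hF : ∃ (A : lp (fun _ : ℕ => 𝕜) q →L[𝕜] F) (B : F →L[𝕜] lp (fun _ : ℕ => 𝕜) q),
      B.comp A = ContinuousLinearMap.id 𝕜 (lp (fun _ : ℕ => 𝕜) q)) :
    ∀ n : ℕ, 1 ≤ n → ¬ HasAP 𝕜 (HomPoly 𝕜 n E F) := by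
  intro n hn hAP
  have hpt : p ≠ ⊤ := (hpq.trans_lt hq).ne
  have hp1 : 1 < p.toReal := by
    have := (ENNReal.toReal_lt_toReal ENNReal.one_ne_top hpt).2 hp
    simpa using this
  have hpq1 : p.toReal ≤ q.toReal := ENNReal.toReal_mono hq.ne hpq
  have hq1 : 1 < q.toReal := hp1.trans_le hpq1
  have hp0 : p ≠ 0 := (zero_lt_one.trans hp).ne'
  obtain ⟨A, B, hAB⟩ := hE
  obtain ⟨A', B', hAB'⟩ := hF
  obtain ⟨I, R, hIR⟩ := APC.exists_IR 𝕜 p hp1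
  obtain ⟨I', R', hIR'⟩ := APC.exists_IR 𝕜 q hq1
  have he : A (lp.single p 0 1) ≠ 0 := by
    intro h
    have h1 : B (A (lp.single p 0 1)) = lp.single p 0 1 := congrArg (fun T => T (lp.single p 0 1)) hAB
    rw [h, map_zero] at h1
    have h2 := congrArg (fun x : lp (fun _ : ℕ => 𝕜) p => x 0) h1
    simp at h2
  exact APC.not_ap_ZZ (APC.ap_YY p q (zero_lt_one.trans hp1) hpq1 hp0
    (APC.op_retract I R hIR I' R' hIR' (APC.op_retract A B hAB A' B' hAB'
      (APC.poly_retract n hn _ he hAP))))
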